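/- arXiv:1404.6647 — 2 statements merged into one kernel-verified Lean document; each statement's English description precedes it below -/
import Mathlib

section
/- Let 𝔣 be an additive, κ-Lipschitz, concave graph parameter and let Ψ(μ) := lim_{n→∞} E[𝔣(𝔾^iid_{μ,n})]/n for each probability measure μ on ℕ with finite mean. Then Ψ is concave: for any two probability measures μ, μ' on ℕ with finite mean and any θ ∈ [0,1], θ·Ψ(μ) + (1−θ)·Ψ(μ') ≤ Ψ(θμ + (1−θ)μ'). -/
open Finset Filter Topology MeasureTheory
open scoped Classical BigOperators ENNReal

structure Multigraph where
  (V : Type)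
  [fintypeV : Fintype V]
  (edges : Multiset (Sym2 V))

attribute [instance] Multigraph.fintypeV

def Multigraph.addEdge (G : Multigraph) (i j : G.V) : Multigraph :=
  { V := G.V, edges := s(i, j) ::ₘ G.edges }

def Multigraph.disjUnion (G₁ G₂ : Multigraph) : Multigraph :=
  { V := G₁.V ⊕ G₂.V,
    edges := G₁.edges.map (Sym2.map Sum.inl) + G₂.edges.map (Sym2.map Sum.inr) }

/-- A graph parameter is invariant under graph isomorphism. -/
def GraphParam.Invariant (f : Multigraph → ℝ) : Prop :=
  ∀ (G₁ G₂ : Multigraph) (e : G₁.V ≃ G₂.V),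
    G₂.edges = G₁.edges.map (Sym2.map e) → f G₁ = f G₂

def GraphParam.Additive (f : Multigraph → ℝ) : Prop :=
  ∀ G₁ G₂ : Multigraph, f (G₁.disjUnion G₂) = f G₁ + f G₂

def GraphParam.Lipschitz (f : Multigraph → ℝ) (κ : ℝ) : Prop :=
  ∀ (G : Multigraph) (i j : G.V), |f (G.addEdge i j) - f G| ≤ κ

def GraphParam.Concave (f : Multigraph → ℝ) : Prop :=
  ∀ (G : Multigraph) (x : G.V → ℝ), (∑ i, x i) = 0 →
    ∑ i, ∑ j, (f (G.addEdge i j) - f G) * x i * x j ≤ 0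

abbrev HalfEdge (V : Type) (d : V → ℕ) : Type := Σ i : V, Fin (d i)

def IsPairMatching {α : Type} (m : Finset (Sym2 α)) : Prop :=
  (∀ p ∈ m, ¬ p.IsDiag) ∧
    ∀ p ∈ m, ∀ q ∈ m, p ≠ q → ∀ h : α, h ∈ p → h ∉ q

def IsMaximalMatching {α : Type} (m : Finset (Sym2 α)) : Prop :=
  IsPairMatching m ∧ ∀ m' : Finset (Sym2 α), IsPairMatching m' → m ⊆ m' → m' = m

/-- The multigraph `G[m]` induced on `V` by a matching `m` of the half-edges. -/
def matchingGraph (V : Type) [Fintype V] (d : V → ℕ)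
    (m : Finset (Sym2 (HalfEdge V d))) : Multigraph :=
  { V := V, edges := m.val.map (Sym2.map Sigma.fst) }

noncomputable def maximalMatchings (V : Type) [Fintype V] [DecidableEq V] (d : V → ℕ) :
    Finset (Finset (Sym2 (HalfEdge V d))) :=
  Finset.univ.filter fun m => IsMaximalMatching m

/-- `E[f(𝔾_d)]`: expectation of `f` under the configuration model with degrees `d`. -/
noncomputable def configExpect (V : Type) [Fintype V] [DecidableEq V] (d : V → ℕ)
    (f : Multigraph → ℝ) : ℝ :=
  (∑ m ∈ maximalMatchings V d, f (matchingGraph V d m)) / ((maximalMatchings V d).card : ℝ)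

/-- `E[f(𝔾^iid_{μ,n})]`. -/
noncomputable def iidExpect (μ : ℕ → ℝ) (n : ℕ) (f : Multigraph → ℝ) : ℝ :=
  ∑' D : Fin n → ℕ, (∏ i, μ (D i)) * configExpect (Fin n) D f

noncomputable def tailSum (μ : ℕ → ℝ) (i : ℕ) : ℝ := ∑' k : ℕ, if i ≤ k then μ k else 0

/-- The Wasserstein distance `W(μ, μ') = Σ_{i≥1} |Σ_{k≥i} (μ k - μ' k)|`. -/
noncomputable def wasserstein (μ μ' : ℕ → ℝ) : ℝ :=
  ∑' i : ℕ, |tailSum μ (i + 1) - tailSum μ' (i + 1)|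

/-- Empirical degree distribution of `d : Fin n → ℕ`. -/
noncomputable def empirical (n : ℕ) (d : Fin n → ℕ) : ℕ → ℝ :=
  fun k => ((Finset.univ.filter fun i => d i = k).card : ℝ) / (n : ℝ)

/-- The degree sequences `d n` approach the degree distribution `μ` (with mean `Σ k·μ(k)`). -/
def Approaches (d : (n : ℕ) → Fin n → ℕ) (μ : ℕ → ℝ) : Prop :=
  (∀ k : ℕ, Tendsto (fun n => empirical n (d n) k) atTop (nhds (μ k))) ∧
    Tendsto (fun n => (∑ i, (d n i : ℝ)) / (n : ℝ)) atTop
      (nhds (∑' k : ℕ, (k : ℝ) * μ k))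

set_option linter.unusedSectionVars false
set_option linter.unusedSimpArgs false
/-! ### Matchings on a set of half-edges with two sides -/

section Core

variable {H V : Type} [Fintype H] [Fintype V]

/-- The half-edge `x` is not matched by `m`. -/
def Unm (m : Finset (Sym2 H)) (x : H) : Prop := ∀ y, s(x, y) ∉ m

/-- The multigraph induced by a matching, for a general map from half-edges to vertices. -/
def gr (π : H → V) (m : Finset (Sym2 H)) : Multigraph :=
  { V := V, edges := m.val.map (Sym2.map π) }

/-- Number of darts of `m` from side `a` to side `b`. -/
noncomputable def dcount (A : H → Bool) (m : Finset (Sym2 H)) (a b : Bool) : ℕ :=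
  (univ.filter fun z : H × H => s(z.1, z.2) ∈ m ∧ A z.1 = a ∧ A z.2 = b).card

noncomputable def MM (A : H → Bool) (P Q r : ℕ) : Finset (Finset (Sym2 H)) :=
  univ.filter fun m => IsPairMatching m ∧ dcount A m true true = P ∧
    dcount A m false false = Q ∧ dcount A m true false = r

noncomputable def UU (A : H → Bool) (m : Finset (Sym2 H)) (a : Bool) : Finset H :=
  univ.filter fun x => Unm m x ∧ A x = a

/-- Ordered pairs of distinct unmatched half-edges on sides `a`, `b`. -/
noncomputable def prs (A : H → Bool) (m : Finset (Sym2 H)) (a b : Bool) : Finset (H × H) :=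
  univ.filter fun z => z.1 ≠ z.2 ∧ Unm m z.1 ∧ Unm m z.2 ∧ A z.1 = a ∧ A z.2 = b

noncomputable def nA (A : H → Bool) (a : Bool) : ℕ := (univ.filter fun x => A x = a).card


lemma pm_unique {m : Finset (Sym2 H)} (hm : IsPairMatching m) {x y z : H}
    (h1 : s(x, y) ∈ m) (h2 : s(x, z) ∈ m) : y = z := by
  by_contra hne
  have hne' : s(x, y) ≠ s(x, z) := by
    intro h
    rw [Sym2.congr_right] at h
    exact hne h
  exact hm.2 _ h1 _ h2 hne' x (Sym2.mem_mk_left _ _) (Sym2.mem_mk_left _ _)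

lemma pm_ne {m : Finset (Sym2 H)} (hm : IsPairMatching m) {x y : H}
    (h1 : s(x, y) ∈ m) : x ≠ y := by
  intro h
  exact hm.1 _ h1 (by simpa using h)

lemma pm_iff {m : Finset (Sym2 H)} : IsPairMatching m ↔
    (∀ x y, s(x, y) ∈ m → x ≠ y) ∧ ∀ x y z, s(x, y) ∈ m → s(x, z) ∈ m → y = z := by
  constructor
  · intro hm
    exact ⟨fun x y h => pm_ne hm h, fun x y z h1 h2 => pm_unique hm h1 h2⟩
  · rintro ⟨h1, h2⟩
    refine ⟨?_, ?_⟩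
    · intro p hp
      induction p using Sym2.ind with
      | _ x y => simpa using h1 x y hp
    · intro p hp q hq hne h hhp hhq
      obtain ⟨y, rfl⟩ := hhp
      obtain ⟨z, rfl⟩ := hhq
      exact hne (by rw [h2 h y z hp hq])

lemma pm_mono {m m' : Finset (Sym2 H)} (hm : IsPairMatching m') (h : m ⊆ m') :
    IsPairMatching m :=
  ⟨fun p hp => hm.1 p (h hp), fun p hp q hq => hm.2 p (h hp) q (h hq)⟩

lemma unm_notMem {m : Finset (Sym2 H)} {x y : H} (hx : Unm m x) : s(x, y) ∉ m := hx y

lemma mk_eq {x y u v : H} : s(x, y) = s(u, v) ↔ (x = u ∧ y = v) ∨ (x = v ∧ y = u) := by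
  rw [Sym2.eq_iff]

lemma pm_insert {m : Finset (Sym2 H)} (hm : IsPairMatching m) {x y : H} (hxy : x ≠ y)
    (hx : Unm m x) (hy : Unm m y) : IsPairMatching (insert s(x, y) m) := by
  rw [pm_iff] at hm ⊢
  have hx' : ∀ z, s(z, x) ∉ m := fun z => by rw [Sym2.eq_swap]; exact hx z
  have hy' : ∀ z, s(z, y) ∉ m := fun z => by rw [Sym2.eq_swap]; exact hy z
  constructor
  · intro u v h
    rw [Finset.mem_insert, mk_eq] at h
    rcases h with (⟨rfl, rfl⟩ | ⟨rfl, rfl⟩) | h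
    · exact hxy
    · exact hxy.symm
    · exact hm.1 _ _ h
  · intro u v w h1 h2
    rw [Finset.mem_insert, mk_eq] at h1 h2
    rcases h1 with (⟨rfl, rfl⟩ | ⟨rfl, rfl⟩) | h1 <;>
    rcases h2 with (⟨h3, h4⟩ | ⟨h3, h4⟩) | h2
    · exact h4.symm
    · exact absurd h3 hxy
    · exact absurd h2 (hx _)
    · exact absurd h3.symm hxy
    · exact h4.symm
    · exact absurd h2 (hy _)
    · subst h3; exact absurd h1 (hx _)
    · subst h3; exact absurd h1 (hy _)
    · exact hm.2 _ _ _ h1 h2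

lemma pm_erase_unm {m : Finset (Sym2 H)} (hm : IsPairMatching m) {x y : H}
    (h : s(x, y) ∈ m) : Unm (m.erase s(x, y)) x := by
  intro z hz
  rw [Finset.mem_erase] at hz
  exact hz.1 (by rw [pm_unique hm h hz.2])

lemma pm_erase_unm' {m : Finset (Sym2 H)} (hm : IsPairMatching m) {x y : H}
    (h : s(x, y) ∈ m) : Unm (m.erase s(x, y)) y := by
  rw [Sym2.eq_swap] at h ⊢
  exact pm_erase_unm hm h

lemma dcount_insert (A : H → Bool) {m : Finset (Sym2 H)} {x y : H} (hxy : x ≠ y)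
    (hx : s(x, y) ∉ m) (a b : Bool) :
    dcount A (insert s(x, y) m) a b = dcount A m a b +
      ((if A x = a ∧ A y = b then 1 else 0) + (if A y = a ∧ A x = b then 1 else 0)) := by
  have hx2 : s(y, x) ∉ m := by rw [Sym2.eq_swap]; exact hx
  unfold dcount
  have : (univ.filter fun z : H × H => s(z.1, z.2) ∈ insert s(x, y) m ∧ A z.1 = a ∧ A z.2 = b)
      = (univ.filter fun z : H × H => s(z.1, z.2) ∈ m ∧ A z.1 = a ∧ A z.2 = b) ∪
        ((({(x, y)} : Finset (H × H)).filter fun z => A z.1 = a ∧ A z.2 = b) ∪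
        (({(y, x)} : Finset (H × H)).filter fun z => A z.1 = a ∧ A z.2 = b)) := by
    ext ⟨u, v⟩
    simp only [Finset.mem_filter, Finset.mem_univ, true_and, Finset.mem_union,
      Finset.mem_singleton, Finset.mem_insert, mk_eq, Prod.mk.injEq]
    tauto
  rw [this, Finset.card_union_of_disjoint, Finset.card_union_of_disjoint]
  · congr 2
    · rw [Finset.filter_singleton]; split_ifs <;> simp_all
    · rw [Finset.filter_singleton]; split_ifs <;> simp_all
  · rw [Finset.disjoint_left]
    rintro ⟨u, v⟩ h1 h2
    simp only [Finset.mem_filter, Finset.mem_singleton, Prod.mk.injEq] at h1 h2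
    exact hxy (h1.1.1.symm.trans h2.1.1)
  · rw [Finset.disjoint_left]
    rintro ⟨u, v⟩ h1 h2
    simp only [Finset.mem_filter, Finset.mem_singleton, Prod.mk.injEq, Finset.mem_union,
      Finset.mem_univ, true_and] at h1 h2
    rcases h2 with ⟨⟨rfl, rfl⟩, -⟩ | ⟨⟨rfl, rfl⟩, -⟩
    · exact hx h1.1
    · exact hx2 h1.1

lemma dcount_even (A : H → Bool) (a : Bool) (m : Finset (Sym2 H)) (hm : IsPairMatching m) :
    Even (dcount A m a a) := by
  induction m using Finset.induction_on with
  | empty => simp [dcount]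
  | insert e s he ih =>
    have ih := ih (pm_mono hm (Finset.subset_insert _ _))
    induction e using Sym2.ind with
    | _ x y =>
      rw [dcount_insert A (pm_ne hm (Finset.mem_insert_self _ _)) he]
      refine ih.add ?_
      by_cases h : A x = a ∧ A y = a
      · simp [h]
      · have : ¬ (A y = a ∧ A x = a) := fun h' => h ⟨h'.2, h'.1⟩
        simp [h, this]

lemma dcount_symm (A : H → Bool) (a b : Bool) (m : Finset (Sym2 H)) :
    dcount A m a b = dcount A m b a := by
  unfold dcount
  refine Finset.card_nbij' Prod.swap Prod.swap ?_ ?_ ?_ ?_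
  · rintro ⟨x, y⟩ h
    simp only [Finset.mem_coe, Finset.mem_filter, Finset.mem_univ, true_and, Prod.swap] at h ⊢
    rw [Sym2.eq_swap]; tauto
  · rintro ⟨x, y⟩ h
    simp only [Finset.mem_coe, Finset.mem_filter, Finset.mem_univ, true_and, Prod.swap] at h ⊢
    rw [Sym2.eq_swap]; tauto
  · intro _ _; simp
  · intro _ _; simp

lemma card_UU (A : H → Bool) (a : Bool) (m : Finset (Sym2 H)) (hm : IsPairMatching m) :
    (UU A m a).card + dcount A m a true + dcount A m a false = nA A a := by
  have h1 : dcount A m a true + dcount A m a false =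
      (univ.filter fun x => ¬ Unm m x ∧ A x = a).card := by
    unfold dcount
    rw [← Finset.card_union_of_disjoint]
    · refine Finset.card_nbij Prod.fst ?_ ?_ ?_
      · rintro ⟨x, y⟩ h
        simp only [Finset.mem_coe, Finset.mem_union, Finset.mem_filter, Finset.mem_univ, true_and] at h ⊢
        unfold Unm
        push Not
        rcases h with h | h
        · exact ⟨⟨y, h.1⟩, h.2.1⟩
        · exact ⟨⟨y, h.1⟩, h.2.1⟩
      · rintro ⟨x, y⟩ h ⟨x', y'⟩ h' (rfl : x = x')
        simp only [Finset.mem_coe, Finset.mem_union, Finset.mem_filter, Finset.mem_univ, true_and] at h h'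
        have e1 : s(x, y) ∈ m := by tauto
        have e2 : s(x, y') ∈ m := by tauto
        rw [pm_unique hm e1 e2]
      · rintro x h
        simp only [Finset.mem_coe, Finset.mem_filter, Finset.mem_univ, true_and] at h
        unfold Unm at h
        push Not at h
        obtain ⟨⟨y, hy⟩, hx⟩ := h
        refine ⟨(x, y), ?_, rfl⟩
        simp only [Finset.mem_coe, Finset.mem_union, Finset.mem_filter, Finset.mem_univ, true_and]
        cases hA : A y <;> simp [hy, hx]
    · rw [Finset.disjoint_left]
      rintro ⟨u, v⟩ h1 h2
      simp only [Finset.mem_filter] at h1 h2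
      simp [h1.2.2.2] at h2
  rw [add_assoc, h1]
  unfold UU nA
  rw [← Finset.card_union_of_disjoint]
  · congr 1
    ext x
    simp only [Finset.mem_union, Finset.mem_filter, Finset.mem_univ, true_and]
    tauto
  · rw [Finset.disjoint_left]
    intro x h1 h2
    simp only [Finset.mem_filter] at h1 h2
    exact h2.2.1 h1.2.1

/-- Increments of the three counters when an edge with sides `a, b` is added. -/
lemma mem_MM (A : H → Bool) (P Q r : ℕ) (m : Finset (Sym2 H)) :
    m ∈ MM A P Q r ↔ IsPairMatching m ∧ dcount A m true true = P ∧
    dcount A m false false = Q ∧ dcount A m true false = r := by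
  simp [MM]

lemma double_count (A : H → Bool) (a b : Bool) (P Q r P' Q' r' : ℕ)
    (hP : P' = P + ((if a = true ∧ b = true then 1 else 0) + if b = true ∧ a = true then 1 else 0))
    (hQ : Q' = Q + ((if a = false ∧ b = false then 1 else 0) +
      if b = false ∧ a = false then 1 else 0))
    (hr : r' = r + ((if a = true ∧ b = false then 1 else 0) + if b = true ∧ a = false then 1 else 0))
    (φ : Finset (Sym2 H) → ℝ) :
    ∑ m ∈ MM A P Q r, ∑ z ∈ prs A m a b, φ (insert s(z.1, z.2) m) =
      ∑ m ∈ MM A P' Q' r', (dcount A m a b : ℝ) * φ m := by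
  have h2 : ∀ m, (dcount A m a b : ℝ) * φ m = ∑ z ∈ (univ.filter fun z : H × H =>
      s(z.1, z.2) ∈ m ∧ A z.1 = a ∧ A z.2 = b), φ m := by
    intro m
    rw [Finset.sum_const, nsmul_eq_mul]; rfl
  simp_rw [h2]
  rw [Finset.sum_sigma', Finset.sum_sigma']
  refine Finset.sum_nbij' (fun w => ⟨insert s(w.2.1, w.2.2) w.1, w.2⟩)
    (fun w => ⟨w.1.erase s(w.2.1, w.2.2), w.2⟩) ?_ ?_ ?_ ?_ ?_
  · rintro ⟨m, x, y⟩ h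
    simp only [Finset.mem_sigma, mem_MM, prs, Finset.mem_filter, Finset.mem_univ, true_and] at h ⊢
    obtain ⟨⟨hm, h1, h2, h3⟩, hxy, hx, hy, hAx, hAy⟩ := h
    have hn : s(x, y) ∉ m := hx y
    refine ⟨⟨pm_insert hm hxy hx hy, ?_, ?_, ?_⟩, Finset.mem_insert_self _ _, hAx, hAy⟩
    · rw [dcount_insert A hxy hn, h1, hAx, hAy, hP]
    · rw [dcount_insert A hxy hn, h2, hAx, hAy, hQ]
    · rw [dcount_insert A hxy hn, h3, hAx, hAy, hr]
  · rintro ⟨m, x, y⟩ h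
    simp only [Finset.mem_sigma, mem_MM, prs, Finset.mem_filter, Finset.mem_univ, true_and] at h ⊢
    obtain ⟨⟨hm, h1, h2, h3⟩, hmem, hAx, hAy⟩ := h
    have hxy := pm_ne hm hmem
    have hn : s(x, y) ∉ m.erase s(x, y) := Finset.notMem_erase _ _
    have k1 := dcount_insert A hxy hn true true
    have k2 := dcount_insert A hxy hn false false
    have k3 := dcount_insert A hxy hn true false
    rw [Finset.insert_erase hmem, hAx, hAy] at k1 k2 k3
    refine ⟨⟨pm_mono hm (Finset.erase_subset _ _), ?_, ?_, ?_⟩, hxy, pm_erase_unm hm hmem,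
      pm_erase_unm' hm hmem, hAx, hAy⟩
    · omega
    · omega
    · omega
  · rintro ⟨m, x, y⟩ h
    simp only [Finset.mem_sigma, mem_MM, prs, Finset.mem_filter, Finset.mem_univ, true_and] at h ⊢
    rw [Finset.erase_insert (h.2.2.1 y)]
  · rintro ⟨m, x, y⟩ h
    simp only [Finset.mem_sigma, mem_MM, Finset.mem_filter, Finset.mem_univ, true_and] at h ⊢
    rw [Finset.insert_erase h.2.1]
  · rintro ⟨m, x, y⟩ h
    rfl

/-- Average of `φ` over the matchings with given counters. -/
noncomputable def FF (A : H → Bool) (φ : Finset (Sym2 H) → ℝ) (p q r : ℕ) : ℝ :=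
  (∑ m ∈ MM A (2 * p) (2 * q) r, φ m) / ((MM A (2 * p) (2 * q) r).card : ℝ)

/-- Averaging one more edge. -/
lemma FF_step (A : H → Bool) (a b : Bool) (p q r p' q' r' : ℕ)
    (hP : 2 * p' = 2 * p + ((if a = true ∧ b = true then 1 else 0) +
      if b = true ∧ a = true then 1 else 0))
    (hQ : 2 * q' = 2 * q + ((if a = false ∧ b = false then 1 else 0) +
      if b = false ∧ a = false then 1 else 0))
    (hr : r' = r + ((if a = true ∧ b = false then 1 else 0) + if b = true ∧ a = false then 1 else 0))
    (N : ℕ) (hN : 0 < N) (hN' : ∀ m ∈ MM A (2 * p) (2 * q) r, (prs A m a b).card = N)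
    (φ : Finset (Sym2 H) → ℝ) :
    FF A φ p' q' r' = (∑ m ∈ MM A (2 * p) (2 * q) r,
      (∑ z ∈ prs A m a b, φ (insert s(z.1, z.2) m)) / (N : ℝ)) /
        ((MM A (2 * p) (2 * q) r).card : ℝ) := by
  have hNR : (0 : ℝ) < N := by exact_mod_cast hN
  obtain ⟨c, hc0, hc⟩ : ∃ c : ℕ, 0 < c ∧ ∀ m ∈ MM A (2 * p') (2 * q') r', dcount A m a b = c := by
    rcases a with _ | _ <;> rcases b with _ | _
    · refine ⟨2 * q', by simp at hQ; omega, fun m hm => ((mem_MM _ _ _ _ _).1 hm).2.2.1⟩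
    · refine ⟨r', by simp at hr; omega, fun m hm => ?_⟩
      rw [dcount_symm]; exact ((mem_MM _ _ _ _ _).1 hm).2.2.2
    · refine ⟨r', by simp at hr; omega, fun m hm => ?_⟩
      exact ((mem_MM _ _ _ _ _).1 hm).2.2.2
    · refine ⟨2 * p', by simp at hP; omega, fun m hm => ((mem_MM _ _ _ _ _).1 hm).2.1⟩
  have hcR : (0 : ℝ) < c := by exact_mod_cast hc0
  have d1 := double_count A a b _ _ _ _ _ _ hP hQ hr φ
  have d2 := double_count A a b _ _ _ _ _ _ hP hQ hr (fun _ => 1)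
  have e1 : ∀ ψ : Finset (Sym2 H) → ℝ, ∑ m ∈ MM A (2 * p') (2 * q') r', (dcount A m a b : ℝ) * ψ m
      = c * ∑ m ∈ MM A (2 * p') (2 * q') r', ψ m := by
    intro ψ
    rw [Finset.mul_sum]
    exact Finset.sum_congr rfl fun m hm => by rw [hc m hm]
  rw [e1] at d1 d2
  have e2 : ∑ m ∈ MM A (2 * p) (2 * q) r, ∑ z ∈ prs A m a b, (1 : ℝ) =
      (MM A (2 * p) (2 * q) r).card * N := by
    rw [Finset.sum_congr rfl (g := fun _ => (N : ℝ))]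
    · simp
    · intro m hm
      simp [hN' m hm]
  rw [e2] at d2
  rw [Finset.sum_const, nsmul_eq_mul, mul_one] at d2
  rw [← Finset.sum_div, d1]
  unfold FF
  set X := ∑ m ∈ MM A (2 * p') (2 * q') r', φ m
  set K := ((MM A (2 * p) (2 * q) r).card : ℝ)
  set K' := ((MM A (2 * p') (2 * q') r').card : ℝ)
  rw [div_div, mul_comm (N : ℝ), d2, mul_div_mul_left _ _ hcR.ne']

end Core

section Core2

variable {H V : Type} [Fintype H] [Fintype V]

lemma gr_insert (π : H → V) {m : Finset (Sym2 H)} {x y : H} (h : s(x, y) ∉ m) :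
    gr π (insert s(x, y) m) = Multigraph.addEdge (gr π m) (π x) (π y) := by
  unfold gr Multigraph.addEdge
  simp only [Finset.insert_val_of_notMem h, Multiset.map_cons, Sym2.map_mk]

/-- The increment of `f` for adding an edge between the vertices of two half-edges. -/
noncomputable def inc (f : Multigraph → ℝ) (π : H → V) (m : Finset (Sym2 H)) (x y : H) : ℝ :=
  f (Multigraph.addEdge (gr π m) (π x) (π y)) - f (gr π m)

lemma inc_symm (f : Multigraph → ℝ) (π : H → V) (m : Finset (Sym2 H)) (x y : H) :
    inc f π m x y = inc f π m y x := by
  have : Multigraph.addEdge (gr π m) (π x) (π y) = Multigraph.addEdge (gr π m) (π y) (π x) := by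
    have h : s(π x, π y) = s(π y, π x) := Sym2.eq_swap
    exact congrArg (fun e => (⟨V, e ::ₘ (gr π m).edges⟩ : Multigraph)) h
  unfold inc
  rw [this]

lemma inc_abs {f : Multigraph → ℝ} {κ : ℝ} (hlip : GraphParam.Lipschitz f κ) (π : H → V)
    (m : Finset (Sym2 H)) (x y : H) : |inc f π m x y| ≤ κ := hlip _ _ _

lemma sum_push (π : H → V) (w : H → ℝ) (g : V → ℝ) :
    ∑ v, g v * (∑ h, if π h = v then w h else 0) = ∑ h, g (π h) * w h := by
  simp_rw [Finset.mul_sum]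
  rw [Finset.sum_comm]
  refine Finset.sum_congr rfl fun h _ => ?_
  simp

lemma inc_conc {f : Multigraph → ℝ} (hconc : GraphParam.Concave f) (π : H → V)
    (m : Finset (Sym2 H)) (w : H → ℝ) (hw : ∑ h, w h = 0) :
    ∑ h, ∑ h', inc f π m h h' * w h * w h' ≤ 0 := by
  have h0 := hconc (gr π m) (fun v : V => ∑ h, if π h = v then w h else 0) (by
    have := sum_push π w (fun _ => 1)
    simp only [one_mul] at this
    exact this.trans hw)
  refine le_trans (le_of_eq ?_) h0
  let D : V → V → ℝ := fun i j => f (Multigraph.addEdge (gr π m) i j) - f (gr π m)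
  let x : V → ℝ := fun v : V => ∑ h, if π h = v then w h else 0
  show ∑ h, ∑ h', D (π h) (π h') * w h * w h' = ∑ i : V, ∑ j : V, D i j * x i * x j
  have e1 : ∀ i, ∑ j : V, D i j * x i * x j = (∑ h', D i (π h') * w h') * x i := by
    intro i
    have := sum_push π w (fun j => D i j * x i)
    rw [this, Finset.sum_mul]
    exact Finset.sum_congr rfl fun _ _ => by ring
  simp_rw [e1]
  rw [sum_push π w (fun i => ∑ h', D i (π h') * w h')]
  refine Finset.sum_congr rfl fun h _ => ?_
  rw [Finset.sum_mul]
  exact Finset.sum_congr rfl fun _ _ => by ring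

lemma mem_UU (A : H → Bool) (m : Finset (Sym2 H)) (a : Bool) (x : H) :
    x ∈ UU A m a ↔ Unm m x ∧ A x = a := by
  simp [UU]

lemma prs_diag (A : H → Bool) (m : Finset (Sym2 H)) (a : Bool) :
    prs A m a a = (UU A m a).offDiag := by
  ext ⟨x, y⟩
  simp only [prs, UU, Finset.mem_filter, Finset.mem_univ, true_and, Finset.mem_offDiag]
  tauto

lemma prs_cross (A : H → Bool) (m : Finset (Sym2 H)) :
    prs A m true false = UU A m true ×ˢ UU A m false := by
  ext ⟨x, y⟩
  simp only [prs, UU, Finset.mem_filter, Finset.mem_univ, true_and, Finset.mem_product]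
  constructor
  · tauto
  · rintro ⟨h1, h2⟩
    refine ⟨?_, h1.1, h2.1, h1.2, h2.2⟩
    rintro rfl
    rw [h1.2] at h2
    simp at h2

/-- Local comparison at a fixed partial matching. -/
lemma local_ineq {f : Multigraph → ℝ} {κ : ℝ} (hlip : GraphParam.Lipschitz f κ)
    (hconc : GraphParam.Concave f) (A : H → Bool) (π : H → V) (m : Finset (Sym2 H))
    (u v : ℕ) (hu : (UU A m true).card = u) (hv : (UU A m false).card = v)
    (hu2 : 2 ≤ u) (hv2 : 2 ≤ v) :
    (∑ z ∈ prs A m true true, inc f π m z.1 z.2) / ((u * (u - 1) : ℕ) : ℝ) +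
    (∑ z ∈ prs A m false false, inc f π m z.1 z.2) / ((v * (v - 1) : ℕ) : ℝ) -
    2 * ((∑ z ∈ prs A m true false, inc f π m z.1 z.2) / ((u * v : ℕ) : ℝ)) ≤
      2 * κ / u + 2 * κ / v := by
  have hu0 : (2 : ℝ) ≤ u := by exact_mod_cast hu2
  have hv0 : (2 : ℝ) ≤ v := by exact_mod_cast hv2
  set D := inc f π m with hD
  set UA := UU A m true with hUA
  set UB := UU A m false with hUB
  have hconc' := inc_conc hconc π m
    (fun h => (if h ∈ UA then (1 : ℝ) / u else 0) - (if h ∈ UB then (1 : ℝ) / v else 0)) (by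
      rw [Finset.sum_sub_distrib, ← Finset.sum_filter, ← Finset.sum_filter]
      simp only [Finset.filter_mem_eq_inter, Finset.univ_inter, Finset.sum_const, hu, hv,
        nsmul_eq_mul]
      field_simp
      simp)
  have expand : ∑ h, ∑ h', inc f π m h h' *
      ((if h ∈ UA then (1 : ℝ) / u else 0) - (if h ∈ UB then (1 : ℝ) / v else 0)) *
      ((if h' ∈ UA then (1 : ℝ) / u else 0) - (if h' ∈ UB then (1 : ℝ) / v else 0)) =
      (∑ h ∈ UA, ∑ h' ∈ UA, D h h') / (u * u) + (∑ h ∈ UB, ∑ h' ∈ UB, D h h') / (v * v)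
       - 2 * ((∑ h ∈ UA, ∑ h' ∈ UB, D h h') / (u * v)) := by
    have g : ∀ (X Y : Finset H) (c d : ℝ), ∑ h, ∑ h', D h h' * (if h ∈ X then c else 0) *
        (if h' ∈ Y then d else 0) = (∑ h ∈ X, ∑ h' ∈ Y, D h h') * (c * d) := by
      intro X Y c d
      have : ∀ h h', D h h' * (if h ∈ X then c else 0) * (if h' ∈ Y then d else 0) =
        if h ∈ X then (if h' ∈ Y then D h h' * (c * d) else 0) else 0 := by
        intro h h'
        split_ifs <;> ring
      simp_rw [this]
      have h2 : ∀ h, (∑ h', if h ∈ X then (if h' ∈ Y then D h h' * (c * d) else 0) else 0) =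
        if h ∈ X then (∑ h' ∈ Y, D h h' * (c * d)) else 0 := by
        intro h
        split_ifs
        · rw [← Finset.sum_filter]; simp
        · simp
      simp_rw [h2]
      rw [← Finset.sum_filter, Finset.sum_mul]
      simp only [Finset.filter_mem_eq_inter, Finset.univ_inter, Finset.sum_mul]
    have sw : ∑ h ∈ UB, ∑ h' ∈ UA, D h h' = ∑ h ∈ UA, ∑ h' ∈ UB, D h h' := by
      rw [Finset.sum_comm]
      exact Finset.sum_congr rfl fun _ _ => Finset.sum_congr rfl fun _ _ => inc_symm f π m _ _
    have e : ∀ h h', inc f π m h h' *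
      ((if h ∈ UA then (1 : ℝ) / u else 0) - (if h ∈ UB then (1 : ℝ) / v else 0)) *
      ((if h' ∈ UA then (1 : ℝ) / u else 0) - (if h' ∈ UB then (1 : ℝ) / v else 0)) =
      D h h' * (if h ∈ UA then (1 : ℝ) / u else 0) * (if h' ∈ UA then (1 : ℝ) / u else 0) +
      D h h' * (if h ∈ UB then (1 : ℝ) / v else 0) * (if h' ∈ UB then (1 : ℝ) / v else 0) -
      D h h' * (if h ∈ UA then (1 : ℝ) / u else 0) * (if h' ∈ UB then (1 : ℝ) / v else 0) -
      D h h' * (if h ∈ UB then (1 : ℝ) / v else 0) * (if h' ∈ UA then (1 : ℝ) / u else 0) := by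
      intro h h'; ring
    simp_rw [e, Finset.sum_sub_distrib, Finset.sum_add_distrib, g, sw]
    field_simp
    ring
  rw [expand] at hconc'
  have rep : ∀ (X : Finset H) (n : ℕ), X.card = n → 2 ≤ n →
      (∑ z ∈ X.offDiag, D z.1 z.2) / ((n * (n - 1) : ℕ) : ℝ) - 2 * κ / n ≤
        (∑ h ∈ X, ∑ h' ∈ X, D h h') / (n * n) := by
    intro X n hX hn
    have hn0 : (2 : ℝ) ≤ n := by exact_mod_cast hn
    have s1 : ∑ h ∈ X, ∑ h' ∈ X, D h h' = ∑ h ∈ X, D h h + ∑ z ∈ X.offDiag, D z.1 z.2 := by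
      rw [← Finset.sum_product' (f := fun h h' => D h h'), ← Finset.diag_union_offDiag,
        Finset.sum_union (Finset.disjoint_diag_offDiag X), Finset.sum_diag]
    have s2 : -(n * κ) ≤ ∑ h ∈ X, D h h := by
      have : ∑ h ∈ X, (-κ) ≤ ∑ h ∈ X, D h h :=
        Finset.sum_le_sum fun h _ => (abs_le.1 (inc_abs hlip π m h h)).1
      simpa [hX] using this
    have s3 : ∑ z ∈ X.offDiag, D z.1 z.2 ≤ n * (n - 1) * κ := by
      have : ∑ z ∈ X.offDiag, D z.1 z.2 ≤ ∑ z ∈ X.offDiag, κ :=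
        Finset.sum_le_sum fun z _ => (abs_le.1 (inc_abs hlip π m z.1 z.2)).2
      refine this.trans (le_of_eq ?_)
      rw [Finset.sum_const, Finset.offDiag_card, hX, nsmul_eq_mul, Nat.cast_sub (by nlinarith)]
      push_cast; ring
    rw [s1]
    push_cast [Nat.cast_sub (show 1 ≤ n by omega)]
    set T := ∑ z ∈ X.offDiag, D z.1 z.2
    set E := ∑ h ∈ X, D h h
    have hn1 : (0 : ℝ) < n - 1 := by linarith
    have hnp : (0 : ℝ) < n := by linarith
    have k1 : T / (n * (n - 1)) - T / (n * n) ≤ κ / n := by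
      have : T / (n * (n - 1)) - T / (n * n) = T / (n * (n - 1)) / n := by
        field_simp; ring
      rw [this]
      gcongr
      rw [div_le_iff₀ (by positivity)]
      linarith
    have k2 : - (κ / n) ≤ E / (n * n) := by
      rw [le_div_iff₀ (by positivity)]
      have : -(κ / n) * (n * n) = -(n * κ) := by field_simp
      linarith
    have k3 : (E + T) / (n * n) = E / (n * n) + T / (n * n) := add_div _ _ _
    have k4 : 2 * κ / n = κ / n + κ / n := by ring
    rw [k3, k4]
    linarith
  rw [prs_diag, prs_diag, prs_cross, Finset.sum_product]
  have r1 := rep UA u hu hu2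
  have r2 := rep UB v hv hv2
  push_cast at r1 r2 ⊢
  linarith

/-- `φ` evaluated on matchings. -/
noncomputable def ph (f : Multigraph → ℝ) (π : H → V) (m : Finset (Sym2 H)) : ℝ := f (gr π m)

lemma UU_card_MM (A : H → Bool) {p q r : ℕ} {m : Finset (Sym2 H)}
    (hm : m ∈ MM A (2 * p) (2 * q) r) :
    (UU A m true).card + 2 * p + r = nA A true ∧ (UU A m false).card + 2 * q + r = nA A false := by
  rw [mem_MM] at hm
  obtain ⟨h1, h2, h3, h4⟩ := hm
  have e1 := card_UU A true m h1
  have e2 := card_UU A false m h1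
  rw [dcount_symm A false true] at e2
  omega

/-- The increments, averaged. -/
lemma FF_diff (f : Multigraph → ℝ) (A : H → Bool) (π : H → V) (a b : Bool) (p q r p' q' r' : ℕ)
    (hP : 2 * p' = 2 * p + ((if a = true ∧ b = true then 1 else 0) +
      if b = true ∧ a = true then 1 else 0))
    (hQ : 2 * q' = 2 * q + ((if a = false ∧ b = false then 1 else 0) +
      if b = false ∧ a = false then 1 else 0))
    (hr : r' = r + ((if a = true ∧ b = false then 1 else 0) + if b = true ∧ a = false then 1 else 0))
    (N : ℕ) (hN : 0 < N) (hN' : ∀ m ∈ MM A (2 * p) (2 * q) r, (prs A m a b).card = N) :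
    FF A (ph f π) p' q' r' - FF A (ph f π) p q r = (∑ m ∈ MM A (2 * p) (2 * q) r,
      (∑ z ∈ prs A m a b, inc f π m z.1 z.2) / (N : ℝ)) /
        ((MM A (2 * p) (2 * q) r).card : ℝ) := by
  have hNR : (0 : ℝ) < N := by exact_mod_cast hN
  rw [FF_step A a b p q r p' q' r' hP hQ hr N hN hN']
  unfold FF
  rw [← sub_div, ← Finset.sum_sub_distrib]
  congr 1
  refine Finset.sum_congr rfl fun m hm => ?_
  have : ∑ z ∈ prs A m a b, inc f π m z.1 z.2 =
      ∑ z ∈ prs A m a b, (ph f π (insert s(z.1, z.2) m) - ph f π m) := by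
    refine Finset.sum_congr rfl fun z hz => ?_
    simp only [prs, Finset.mem_filter] at hz
    unfold ph
    rw [gr_insert π (hz.2.2.1 z.2)]
    rfl
  rw [this, Finset.sum_sub_distrib, Finset.sum_const, hN' m hm, nsmul_eq_mul, sub_div]
  field_simp

lemma FF_lip {f : Multigraph → ℝ} {κ : ℝ} (hκ : 0 ≤ κ) (hlip : GraphParam.Lipschitz f κ)
    (A : H → Bool) (π : H → V) (a b : Bool) (p q r p' q' r' : ℕ)
    (hP : 2 * p' = 2 * p + ((if a = true ∧ b = true then 1 else 0) +
      if b = true ∧ a = true then 1 else 0))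
    (hQ : 2 * q' = 2 * q + ((if a = false ∧ b = false then 1 else 0) +
      if b = false ∧ a = false then 1 else 0))
    (hr : r' = r + ((if a = true ∧ b = false then 1 else 0) + if b = true ∧ a = false then 1 else 0))
    (N : ℕ) (hN : 0 < N) (hN' : ∀ m ∈ MM A (2 * p) (2 * q) r, (prs A m a b).card = N) :
    |FF A (ph f π) p' q' r' - FF A (ph f π) p q r| ≤ κ := by
  have hNR : (0 : ℝ) < N := by exact_mod_cast hN
  rw [FF_diff f A π a b p q r p' q' r' hP hQ hr N hN hN']
  rw [abs_div, Nat.abs_cast]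
  refine div_le_of_le_mul₀ (by positivity) hκ ?_
  refine (Finset.abs_sum_le_sum_abs _ _).trans ?_
  rw [mul_comm κ, ← nsmul_eq_mul, ← Finset.sum_const]
  refine Finset.sum_le_sum fun m hm => ?_
  rw [abs_div, Nat.abs_cast]
  refine div_le_of_le_mul₀ (by positivity) hκ ?_
  refine (Finset.abs_sum_le_sum_abs _ _).trans ?_
  rw [mul_comm, ← nsmul_eq_mul, ← hN' m hm, ← Finset.sum_const]
  exact Finset.sum_le_sum fun z _ => inc_abs hlip π m _ _

lemma prs_card_tt (A : H → Bool) {p q r : ℕ} {u : ℕ} (hu : u + 2 * p + r = nA A true) :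
    ∀ m ∈ MM A (2 * p) (2 * q) r, (prs A m true true).card = u * (u - 1) := by
  intro m hm
  have := (UU_card_MM A hm).1
  rw [prs_diag, Finset.offDiag_card, show (UU A m true).card = u by omega, Nat.mul_sub, mul_one]

lemma prs_card_ff (A : H → Bool) {p q r : ℕ} {v : ℕ} (hv : v + 2 * q + r = nA A false) :
    ∀ m ∈ MM A (2 * p) (2 * q) r, (prs A m false false).card = v * (v - 1) := by
  intro m hm
  have := (UU_card_MM A hm).2
  rw [prs_diag, Finset.offDiag_card, show (UU A m false).card = v by omega, Nat.mul_sub, mul_one]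

lemma prs_card_tf (A : H → Bool) {p q r : ℕ} {u v : ℕ} (hu : u + 2 * p + r = nA A true)
    (hv : v + 2 * q + r = nA A false) :
    ∀ m ∈ MM A (2 * p) (2 * q) r, (prs A m true false).card = u * v := by
  intro m hm
  have := UU_card_MM A hm
  rw [prs_cross, Finset.card_product, show (UU A m true).card = u by omega,
    show (UU A m false).card = v by omega]

section lips

lemma FF_lip_p {f : Multigraph → ℝ} {κ : ℝ} (hκ : 0 ≤ κ)
    (hlip : GraphParam.Lipschitz f κ) (A : H → Bool) (π : H → V) (p q r : ℕ) (h : 2 * (p + 1) + r ≤ nA A true) :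
    |FF A (ph f π) (p + 1) q r - FF A (ph f π) p q r| ≤ κ := by
  obtain ⟨u, hu⟩ := Nat.exists_eq_add_of_le h
  refine FF_lip hκ hlip A π true true p q r (p + 1) q r (by simp; omega) (by simp) (by simp)
    ((u + 2) * (u + 2 - 1)) (by simp) (prs_card_tt A (by omega))

lemma FF_lip_q {f : Multigraph → ℝ} {κ : ℝ} (hκ : 0 ≤ κ)
    (hlip : GraphParam.Lipschitz f κ) (A : H → Bool) (π : H → V) (p q r : ℕ) (h : 2 * (q + 1) + r ≤ nA A false) :
    |FF A (ph f π) p (q + 1) r - FF A (ph f π) p q r| ≤ κ := by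
  obtain ⟨u, hu⟩ := Nat.exists_eq_add_of_le h
  refine FF_lip hκ hlip A π false false p q r p (q + 1) r (by simp) (by simp; omega) (by simp)
    ((u + 2) * (u + 2 - 1)) (by simp) (prs_card_ff A (by omega))

lemma FF_lip_r {f : Multigraph → ℝ} {κ : ℝ} (hκ : 0 ≤ κ)
    (hlip : GraphParam.Lipschitz f κ) (A : H → Bool) (π : H → V) (p q r : ℕ) (h : 2 * p + (r + 1) ≤ nA A true) (h' : 2 * q + (r + 1) ≤ nA A false) :
    |FF A (ph f π) p q (r + 1) - FF A (ph f π) p q r| ≤ κ := by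
  obtain ⟨u, hu⟩ := Nat.exists_eq_add_of_le h
  obtain ⟨v, hv⟩ := Nat.exists_eq_add_of_le h'
  refine FF_lip hκ hlip A π true false p q r p q (r + 1) (by simp) (by simp) (by simp)
    ((u + 1) * (v + 1)) (by simp) (prs_card_tf A (by omega) (by omega))

lemma FF_lip_p' {f : Multigraph → ℝ} {κ : ℝ} (hκ : 0 ≤ κ)
    (hlip : GraphParam.Lipschitz f κ) (A : H → Bool) (π : H → V) (p q r i : ℕ) (h : 2 * (p + i) + r ≤ nA A true) :
    |FF A (ph f π) (p + i) q r - FF A (ph f π) p q r| ≤ κ * i := by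
  induction i with
  | zero => simp
  | succ i ih =>
    have h1 := ih (by omega)
    have h2 := FF_lip_p hκ hlip A π (p + i) q r (by omega)
    rw [abs_le] at *
    push_cast
    rw [← add_assoc]
    constructor <;> linarith

lemma FF_lip_q' {f : Multigraph → ℝ} {κ : ℝ} (hκ : 0 ≤ κ)
    (hlip : GraphParam.Lipschitz f κ) (A : H → Bool) (π : H → V) (p q r i : ℕ) (h : 2 * (q + i) + r ≤ nA A false) :
    |FF A (ph f π) p (q + i) r - FF A (ph f π) p q r| ≤ κ * i := by
  induction i with
  | zero => simp
  | succ i ih =>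
    have h1 := ih (by omega)
    have h2 := FF_lip_q hκ hlip A π p (q + i) r (by omega)
    rw [abs_le] at *
    push_cast
    rw [← add_assoc]
    constructor <;> linarith

lemma FF_lip_r' {f : Multigraph → ℝ} {κ : ℝ} (hκ : 0 ≤ κ)
    (hlip : GraphParam.Lipschitz f κ) (A : H → Bool) (π : H → V) (p q r i : ℕ) (h : 2 * p + (r + i) ≤ nA A true)
    (h' : 2 * q + (r + i) ≤ nA A false) :
    |FF A (ph f π) p q (r + i) - FF A (ph f π) p q r| ≤ κ * i := by
  induction i with
  | zero => simp
  | succ i ih =>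
    have h1 := ih (by omega) (by omega)
    have h2 := FF_lip_r hκ hlip A π p q (r + i) (by omega) (by omega)
    rw [abs_le] at *
    push_cast
    rw [← add_assoc]
    constructor <;> linarith

lemma FF_zero {f : Multigraph → ℝ} {κ : ℝ} (hκ : 0 ≤ κ)
    (hlip : GraphParam.Lipschitz f κ) (A : H → Bool) (π : H → V) (p q r : ℕ) (h : 2 * p + r ≤ nA A true) (h' : 2 * q + r ≤ nA A false) :
    |FF A (ph f π) p q r - FF A (ph f π) 0 0 0| ≤ κ * (p + q + r) := by
  have h1 := FF_lip_p' hκ hlip A π 0 q r p (by omega)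
  have h2 := FF_lip_q' hκ hlip A π 0 0 r q (by omega)
  have h3 := FF_lip_r' hκ hlip A π 0 0 0 r (by omega) (by omega)
  rw [zero_add] at h1 h2 h3
  rw [abs_le] at *
  constructor <;> nlinarith

lemma FF_one_step {f : Multigraph → ℝ} {κ : ℝ} (hκ : 0 ≤ κ)
    (hlip : GraphParam.Lipschitz f κ) (A : H → Bool) (π : H → V) (hconc : GraphParam.Concave f) (p q r u v : ℕ)
    (hu : u + 2 * p + r = nA A true) (hv : v + 2 * q + r = nA A false)
    (hu2 : 2 ≤ u) (hv2 : 2 ≤ v) :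
    (FF A (ph f π) (p + 1) q r + FF A (ph f π) p (q + 1) r) / 2 - (κ / u + κ / v) ≤
      FF A (ph f π) p q (r + 1) := by
  have hu0 : (2 : ℝ) ≤ u := by exact_mod_cast hu2
  have hv0 : (2 : ℝ) ≤ v := by exact_mod_cast hv2
  have e1 := FF_diff f A π true true p q r (p + 1) q r (by simp; omega) (by simp) (by simp)
    (u * (u - 1)) (Nat.mul_pos (by omega) (by omega)) (prs_card_tt A hu)
  have e2 := FF_diff f A π false false p q r p (q + 1) r (by simp) (by simp; omega) (by simp)
    (v * (v - 1)) (Nat.mul_pos (by omega) (by omega)) (prs_card_ff A hv)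
  have e3 := FF_diff f A π true false p q r p q (r + 1) (by simp) (by simp) (by simp)
    (u * v) (Nat.mul_pos (by omega) (by omega)) (prs_card_tf A hu hv)
  have key : (FF A (ph f π) (p + 1) q r - FF A (ph f π) p q r) +
      (FF A (ph f π) p (q + 1) r - FF A (ph f π) p q r) -
      2 * (FF A (ph f π) p q (r + 1) - FF A (ph f π) p q r) ≤ 2 * κ / u + 2 * κ / v := by
    rw [e1, e2, e3, ← add_div, ← mul_div_assoc, ← sub_div, Finset.mul_sum,
      ← Finset.sum_add_distrib, ← Finset.sum_sub_distrib]
    refine div_le_of_le_mul₀ (by positivity) (by positivity) ?_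
    rw [mul_comm (2 * κ / u + 2 * κ / v), ← nsmul_eq_mul, ← Finset.sum_const]
    refine Finset.sum_le_sum fun m hm => ?_
    have := UU_card_MM A hm
    exact local_ineq hlip hconc A π m u v (by omega) (by omega) hu2 hv2
  have a1 : 2 * κ / u = 2 * (κ / u) := by ring
  have a2 : 2 * κ / v = 2 * (κ / v) := by ring
  rw [a1, a2] at key
  linarith

/-- The random walk argument. -/
lemma walk {f : Multigraph → ℝ} {κ : ℝ} (hκ : 0 ≤ κ)
    (hlip : GraphParam.Lipschitz f κ) (A : H → Bool) (π : H → V) (hconc : GraphParam.Concave f) (p q r0 L α β N P Q : ℕ) (hL : 4 ≤ L)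
    (ha : 2 * p + r0 + L + α = nA A true) (hb : 2 * q + r0 + L + β = nA A false)
    (hα : α ≤ 1) (hβ : β ≤ 1) (hN : nA A true + nA A false = N)
    (hP : nA A true ≤ 2 * P + 1) (hP' : 2 * P ≤ nA A true)
    (hQ : nA A false ≤ 2 * Q + 1) (hQ' : 2 * Q ≤ nA A false) (r : ℕ) :
    ∀ i j : ℕ, i + j + r = r0 → 2 * (p + i) + r ≤ nA A true → 2 * (q + j) + r ≤ nA A false →
      FF A (ph f π) P Q 0 - κ * ((L + 1) + (4 * N / (L * L)) * (((j : ℝ) - i) ^ 2 + r) + r * (4 / L))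
        ≤ FF A (ph f π) (p + i) (q + j) r := by
  have hL0 : (4 : ℝ) ≤ L := by exact_mod_cast hL
  have hN0 : (0 : ℝ) ≤ N := by positivity
  induction r with
  | zero =>
    intro i j hij h1 h2
    obtain ⟨s, hs⟩ := Nat.exists_eq_add_of_le (show p + i ≤ P by omega)
    obtain ⟨t, ht⟩ := Nat.exists_eq_add_of_le (show q + j ≤ Q by omega)
    have l1 := FF_lip_p' hκ hlip A π (p + i) Q 0 s (by omega)
    have l2 := FF_lip_q' hκ hlip A π (p + i) (q + j) 0 t (by omega)
    rw [← hs] at l1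
    rw [← ht] at l2
    rw [abs_le] at l1 l2
    have hst : s + t ≤ L + 1 := by omega
    have hst' : (s : ℝ) + t ≤ L + 1 := by exact_mod_cast hst
    have b1 : κ * s + κ * t ≤ κ * (L + 1) := by rw [← mul_add]; gcongr
    have b2 : (0 : ℝ) ≤ κ * ((4 * N / (L * L)) * (((j : ℝ) - i) ^ 2 + (0 : ℕ)) + (0 : ℕ) * (4 / L)) := by
      positivity
    have b3 : κ * ((L + 1) + (4 * N / (L * L)) * (((j : ℝ) - i) ^ 2 + (0 : ℕ)) + (0 : ℕ) * (4 / L)) =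
      κ * (L + 1) + κ * ((4 * N / (L * L)) * (((j : ℝ) - i) ^ 2 + (0 : ℕ)) + (0 : ℕ) * (4 / L)) := by
      ring
    rw [b3]
    linarith
  | succ r ih =>
    intro i j hij h1 h2
    by_cases hx : 2 * |(j : ℤ) - i| ≤ L
    · have hx1 : 2 * ((j : ℤ) - i) ≤ L := by have := le_abs_self ((j : ℤ) - i); omega
      have hx2 : 2 * ((i : ℤ) - j) ≤ L := by have := neg_le_abs ((j : ℤ) - i); omega
      obtain ⟨u, hu⟩ : ∃ u : ℕ, u + 2 * (p + i) + r = nA A true :=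
        ⟨nA A true - (2 * (p + i) + r), by omega⟩
      obtain ⟨v, hv⟩ : ∃ v : ℕ, v + 2 * (q + j) + r = nA A false :=
        ⟨nA A false - (2 * (q + j) + r), by omega⟩
      have hu2 : L ≤ 2 * u := by omega
      have hv2 : L ≤ 2 * v := by omega
      have st := FF_one_step hκ hlip A π hconc (p + i) (q + j) r u v hu hv (by omega) (by omega)
      have i1 := ih (i + 1) j (by omega) (by omega) (by omega)
      have i2 := ih i (j + 1) (by omega) (by omega) (by omega)
      rw [← add_assoc] at i1 i2
      have hu3 : (L : ℝ) ≤ 2 * u := by exact_mod_cast hu2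
      have hv3 : (L : ℝ) ≤ 2 * v := by exact_mod_cast hv2
      have c1 : κ / u ≤ κ * (2 / L) := by
        rw [div_eq_mul_inv]
        gcongr
        rw [inv_eq_one_div, div_le_div_iff₀ (by linarith) (by linarith)]
        linarith
      have c2 : κ / v ≤ κ * (2 / L) := by
        rw [div_eq_mul_inv]
        gcongr
        rw [inv_eq_one_div, div_le_div_iff₀ (by linarith) (by linarith)]
        linarith
      push_cast at i1 i2 ⊢
      set KK : ℝ := 4 * N / (L * L)
      have id1 : κ * ((L + 1) + KK * (((j : ℝ) - i) ^ 2 + (r + 1)) + (r + 1) * (4 / L)) =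
        (κ * ((L + 1) + KK * (((j : ℝ) - (i + 1)) ^ 2 + r) + r * (4 / L)) +
        κ * ((L + 1) + KK * (((j : ℝ) + 1 - i) ^ 2 + r) + r * (4 / L))) / 2 +
        (κ * (2 / L) + κ * (2 / L)) := by
        ring
      rw [id1]
      linarith
    · have z1 := FF_zero hκ hlip A π (p + i) (q + j) (r + 1) h1 h2
      have z2 := FF_zero hκ hlip A π P Q 0 (by omega) (by omega)
      rw [abs_le] at z1 z2
      have b : (((p + i : ℕ) : ℝ) + ((q + j : ℕ) : ℝ) + ((r + 1 : ℕ) : ℝ)) +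
          ((P : ℝ) + Q + (0 : ℕ)) ≤ N := by
        have : ((p + i) + (q + j) + (r + 1)) + (P + Q + 0) ≤ N := by omega
        exact_mod_cast this
      have b' : κ * (((p + i : ℕ) : ℝ) + ((q + j : ℕ) : ℝ) + ((r + 1 : ℕ) : ℝ)) +
          κ * ((P : ℝ) + Q + (0 : ℕ)) ≤ κ * N := by
        rw [← mul_add]; gcongr
      have hx' : (L : ℝ) ≤ 2 * |(j : ℝ) - i| := by
        push Not at hx
        have : ((L : ℤ) : ℝ) ≤ ((2 * |(j : ℤ) - i| : ℤ) : ℝ) := by exact_mod_cast hx.le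
        push_cast at this
        exact this
      have hx2 : (L : ℝ) * L ≤ 4 * ((j : ℝ) - i) ^ 2 := by
        have : (L : ℝ) * L ≤ (2 * |(j : ℝ) - i|) * (2 * |(j : ℝ) - i|) := by gcongr
        have e := sq_abs ((j : ℝ) - i)
        nlinarith
      have b2 : (N : ℝ) ≤ (4 * N / (L * L)) * ((j : ℝ) - i) ^ 2 := by
        rw [div_mul_eq_mul_div, le_div_iff₀ (by positivity)]
        nlinarith
      have b3 : κ * N ≤ κ * ((L + 1) + (4 * N / (L * L)) * (((j : ℝ) - i) ^ 2 + (r + 1 : ℕ)) +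
          (r + 1 : ℕ) * (4 / L)) := by
        gcongr
        rw [mul_add]
        have : (0 : ℝ) ≤ (4 * N / (L * L)) * (r + 1 : ℕ) := by positivity
        have : (0 : ℝ) ≤ (r + 1 : ℕ) * ((4 : ℝ) / L) := by positivity
        linarith
      linarith

/-- Comparison of an arbitrary maximal class with the non-crossing one. -/
lemma FF_compare {f : Multigraph → ℝ} {κ : ℝ} (hκ : 0 ≤ κ)
    (hlip : GraphParam.Lipschitz f κ) (A : H → Bool) (π : H → V) (hconc : GraphParam.Concave f) (p q c L N P Q : ℕ) (hL : 4 ≤ L)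
    (ha : 2 * p + c ≤ nA A true) (hb : 2 * q + c ≤ nA A false)
    (ha' : nA A true ≤ 2 * p + c + 1) (hb' : nA A false ≤ 2 * q + c + 1)
    (hN : nA A true + nA A false = N)
    (hP : nA A true ≤ 2 * P + 1) (hP' : 2 * P ≤ nA A true)
    (hQ : nA A false ≤ 2 * Q + 1) (hQ' : 2 * Q ≤ nA A false) :
    FF A (ph f π) P Q 0 - κ * ((2 * L + 1) + 4 * N * N / (L * L) + N * (4 / L))
        ≤ FF A (ph f π) p q c := by
  have hL0 : (4 : ℝ) ≤ L := by exact_mod_cast hL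
  by_cases hc : c ≤ L
  · have l0 := FF_lip_r' hκ hlip A π p q 0 c (by omega) (by omega)
    obtain ⟨s, hs⟩ := Nat.exists_eq_add_of_le (show p ≤ P by omega)
    obtain ⟨t, ht⟩ := Nat.exists_eq_add_of_le (show q ≤ Q by omega)
    have l1 := FF_lip_p' hκ hlip A π p Q 0 s (by omega)
    have l2 := FF_lip_q' hκ hlip A π p q 0 t (by omega)
    rw [← hs] at l1
    rw [← ht] at l2
    rw [zero_add] at l0
    rw [abs_le] at l0 l1 l2
    have b : (c : ℝ) + s + t ≤ 2 * L + 1 := by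
      have : c + s + t ≤ 2 * L + 1 := by omega
      exact_mod_cast this
    have b1 : κ * c + κ * s + κ * t ≤ κ * (2 * L + 1) := by
      rw [← mul_add, ← mul_add]; gcongr
    have b2 : 0 ≤ κ * (4 * N * N / (L * L) + N * (4 / L)) := by positivity
    rw [add_assoc, mul_add]
    linarith
  · obtain ⟨r0, hr0⟩ := Nat.exists_eq_add_of_le (show L ≤ c by omega)
    have l0 := FF_lip_r' hκ hlip A π p q r0 L (by omega) (by omega)
    have w := walk hκ hlip A π hconc p q r0 L (nA A true - (2 * p + c)) (nA A false - (2 * q + c))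
      N P Q hL (by omega) (by omega) (by omega) (by omega) hN hP hP' hQ hQ' r0 0 0 (by omega)
      (by omega) (by omega)
    rw [add_comm r0 L, ← hr0] at l0
    rw [abs_le] at l0
    simp only [add_zero] at w
    have hr : (r0 : ℝ) ≤ N := by
      have : r0 ≤ N := by omega
      exact_mod_cast this
    have b : κ * ((L + 1) + (4 * N / (L * L)) * ((((0 : ℕ) : ℝ) - (0 : ℕ)) ^ 2 + r0) + r0 * (4 / L)) +
        κ * L ≤ κ * ((2 * L + 1) + 4 * N * N / (L * L) + N * (4 / L)) := by
      rw [← mul_add]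
      refine mul_le_mul_of_nonneg_left ?_ hκ
      have e1 : (4 * N / (L * L)) * ((((0 : ℕ) : ℝ) - (0 : ℕ)) ^ 2 + r0) ≤ 4 * N * N / (L * L) := by
        have : (4 * N * N / (L * L) : ℝ) = (4 * N / (L * L)) * N := by ring
        rw [this]
        gcongr
        simpa using hr
      have e2 : (r0 : ℝ) * (4 / L) ≤ N * (4 / L) := by gcongr
      linarith
    linarith

end lips

end Core2

section Core3

variable {H V : Type} [Fintype H] [Fintype V]

/-- The maximal matchings of a finite set. -/
noncomputable def mx (H : Type) [Fintype H] : Finset (Finset (Sym2 H)) :=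
  univ.filter fun m => IsMaximalMatching m

noncomputable def avgMax (f : Multigraph → ℝ) (π : H → V) : ℝ :=
  (∑ m ∈ mx H, ph f π m) / ((mx H).card : ℝ)

lemma configExpect_eq (V : Type) [Fintype V] [DecidableEq V] (d : V → ℕ) (f : Multigraph → ℝ) :
    configExpect V d f = avgMax f (Sigma.fst : HalfEdge V d → V) := by
  have : maximalMatchings V d = mx (HalfEdge V d) := by
    ext m
    simp [maximalMatchings, mx]
  unfold configExpect avgMax
  rw [this]
  rfl

lemma max_iff {m : Finset (Sym2 H)} : IsMaximalMatching m ↔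
    IsPairMatching m ∧ ∀ x y, Unm m x → Unm m y → x = y := by
  constructor
  · rintro ⟨h1, h2⟩
    refine ⟨h1, fun x y hx hy => ?_⟩
    by_contra hne
    have := h2 _ (pm_insert h1 hne hx hy) (Finset.subset_insert _ _)
    have h3 : s(x, y) ∈ m := by
      rw [← this]; exact Finset.mem_insert_self _ _
    exact hx y h3
  · rintro ⟨h1, h2⟩
    refine ⟨h1, fun m' hm' hsub => ?_⟩
    refine Finset.Subset.antisymm ?_ hsub
    intro e he
    induction e using Sym2.ind with
    | _ x y =>
      by_contra hn
      refine pm_ne hm' he (h2 x y ?_ ?_)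
      · intro z hz
        exact hn (by rw [pm_unique hm' he (hsub hz)]; exact hz)
      · intro z hz
        rw [Sym2.eq_swap] at he hn
        exact hn (by rw [pm_unique hm' he (hsub hz)]; exact hz)

lemma mem_mx {m : Finset (Sym2 H)} : m ∈ mx H ↔
    IsPairMatching m ∧ ∀ x y, Unm m x → Unm m y → x = y := by
  rw [← max_iff]; simp [mx]

lemma mx_nonempty (H : Type) [Fintype H] : (mx H).Nonempty := by
  obtain ⟨m, hm⟩ := (Set.toFinite {m : Finset (Sym2 H) | IsPairMatching m}).exists_maximal
    ⟨∅, by constructor <;> simp⟩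
  refine ⟨m, ?_⟩
  simp only [mx, Finset.mem_filter, Finset.mem_univ, true_and]
  refine ⟨hm.1, fun m' h1 h2 => ?_⟩
  exact Finset.Subset.antisymm (hm.2 h1 h2) h2

lemma UU_total (A : H → Bool) (m : Finset (Sym2 H)) :
    (UU A m true).card + (UU A m false).card = (univ.filter fun x => Unm m x).card := by
  rw [← Finset.card_union_of_disjoint]
  · congr 1
    ext x
    simp only [Finset.mem_union, mem_UU, Finset.mem_filter, Finset.mem_univ, true_and]
    cases A x <;> simp
  · rw [Finset.disjoint_left]
    intro x h1 h2
    rw [mem_UU] at h1 h2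
    rw [h1.2] at h2
    simp at h2

lemma mem_mx' (A : H → Bool) {m : Finset (Sym2 H)} : m ∈ mx H ↔
    IsPairMatching m ∧ (UU A m true).card + (UU A m false).card ≤ 1 := by
  rw [UU_total, mem_mx, Finset.card_le_one]
  simp only [Finset.mem_filter, Finset.mem_univ, true_and]
  constructor
  · rintro ⟨h1, h2⟩
    exact ⟨h1, fun x hx y hy => h2 x y hx hy⟩
  · rintro ⟨h1, h2⟩
    exact ⟨h1, fun x y hx hy => h2 x hx y hy⟩

lemma avgMax_ge (f : Multigraph → ℝ) (π : H → V) (A : H → Bool) (X : ℝ)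
    (hX : ∀ p q c, 2 * p + c ≤ nA A true → 2 * q + c ≤ nA A false →
      nA A true ≤ 2 * p + c + 1 → nA A false ≤ 2 * q + c + 1 → X ≤ FF A (ph f π) p q c) :
    X ≤ avgMax f π := by
  have hpos : (0 : ℝ) < ((mx H).card : ℝ) := by
    exact_mod_cast (mx_nonempty H).card_pos
  unfold avgMax
  rw [le_div_iff₀ hpos]
  have : 0 ≤ ∑ m ∈ mx H, (ph f π m - X) := by
    let key : Finset (Sym2 H) → ℕ × ℕ × ℕ := fun m =>
      (dcount A m true true, dcount A m false false, dcount A m true false)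
    rw [← Finset.sum_fiberwise_of_maps_to (t := (mx H).image key) (g := key)
      (fun m hm => Finset.mem_image_of_mem _ hm)]
    refine Finset.sum_nonneg fun k hk => ?_
    obtain ⟨m0, hm0, rfl⟩ := Finset.mem_image.1 hk
    have hm0' := (mem_mx' A).1 hm0
    obtain ⟨p, hp⟩ := dcount_even A true m0 hm0'.1
    obtain ⟨q, hq⟩ := dcount_even A false m0 hm0'.1
    set c := dcount A m0 true false with hc
    have hmem : m0 ∈ MM A (2 * p) (2 * q) c := by
      rw [mem_MM]; exact ⟨hm0'.1, by omega, by omega, rfl⟩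
    have hU := UU_card_MM A hmem
    have hfib : (mx H).filter (fun m => key m = key m0) = MM A (2 * p) (2 * q) c := by
      ext m
      rw [Finset.mem_filter, mem_MM]
      simp only [key, Prod.mk.injEq]
      constructor
      · rintro ⟨h1, h2, h3, h4⟩
        exact ⟨((mem_mx' A).1 h1).1, by omega, by omega, by omega⟩
      · intro h
        have hU' := UU_card_MM A ((mem_MM A _ _ _ m).2 h)
        exact ⟨(mem_mx' A).2 ⟨h.1, by omega⟩, by omega, by omega, by omega⟩
    rw [hfib]
    have hF := hX p q c (by omega) (by omega) (by omega) (by omega)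
    have hcp : (0 : ℝ) < ((MM A (2 * p) (2 * q) c).card : ℝ) := by
      exact_mod_cast Finset.card_pos.2 ⟨m0, hmem⟩
    unfold FF at hF
    rw [le_div_iff₀ hcp] at hF
    rw [Finset.sum_sub_distrib, Finset.sum_const, nsmul_eq_mul]
    linarith
  rw [Finset.sum_sub_distrib, Finset.sum_const, nsmul_eq_mul] at this
  linarith

/-- The bijection on unordered pairs induced by a bijection. -/
def symE {H H' : Type} (e : H ≃ H') : Sym2 H ≃ Sym2 H' where
  toFun := Sym2.map e
  invFun := Sym2.map e.symm
  left_inv := fun z => by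
    induction z using Sym2.ind with
    | _ x y => simp
  right_inv := fun z => by
    induction z using Sym2.ind with
    | _ x y => simp

lemma avgMax_reindex {H' V' : Type} [Fintype H'] [Fintype V'] {f : Multigraph → ℝ}
    (hinv : GraphParam.Invariant f) (π : H → V) (π' : H' → V') (eH : H ≃ H') (eV : V ≃ V')
    (h : ∀ x, π' (eH x) = eV (π x)) : avgMax f π = avgMax f π' := by
  have hmap : ∀ (m : Finset (Sym2 H)) (x y : H),
      s(eH x, eH y) ∈ Equiv.finsetCongr (symE eH) m ↔ s(x, y) ∈ m := by
    intro m x y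
    rw [Equiv.finsetCongr_apply, Finset.mem_map_equiv]
    simp [symE]
  have hunm : ∀ (m : Finset (Sym2 H)) (x : H),
      Unm (Equiv.finsetCongr (symE eH) m) (eH x) ↔ Unm m x := by
    intro m x
    unfold Unm
    rw [eH.symm.forall_congr_left]
    simp only [Equiv.symm_symm, hmap]
  have hmx : ∀ m : Finset (Sym2 H), m ∈ mx H ↔ Equiv.finsetCongr (symE eH) m ∈ mx H' := by
    intro m
    rw [mem_mx, mem_mx, pm_iff, pm_iff]
    simp only [eH.symm.forall_congr_left, Equiv.symm_symm, hmap, hunm, ne_eq,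
      EmbeddingLike.apply_eq_iff_eq]
  unfold avgMax
  have hcard : (mx H).card = (mx H').card :=
    Finset.card_equiv (Equiv.finsetCongr (symE eH)) hmx
  rw [hcard]
  congr 1
  refine Finset.sum_equiv (Equiv.finsetCongr (symE eH)) hmx ?_
  intro m _
  refine hinv (gr π m) (gr π' _) eV ?_
  simp only [gr, Equiv.finsetCongr_apply, Finset.map_val, Multiset.map_map]
  refine Multiset.map_congr rfl fun e _ => ?_
  induction e using Sym2.ind with
  | _ x y =>
    simp [symE, h]
    exact Or.inl ⟨rfl, rfl⟩

section split

variable {H1 H2 V1 V2 : Type} [Fintype H1] [Fintype H2] [Fintype V1] [Fintype V2]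

noncomputable def glue (j : H1 ⊕ H2 ≃ H) (m1 : Finset (Sym2 H1)) (m2 : Finset (Sym2 H2)) :
    Finset (Sym2 H) :=
  m1.image (Sym2.map (fun x => j (Sum.inl x))) ∪ m2.image (Sym2.map (fun x => j (Sum.inr x)))

lemma mem_glue (j : H1 ⊕ H2 ≃ H) (m1 : Finset (Sym2 H1)) (m2 : Finset (Sym2 H2)) :
    (∀ x y, s(j (Sum.inl x), j (Sum.inl y)) ∈ glue j m1 m2 ↔ s(x, y) ∈ m1) ∧
    (∀ x y, s(j (Sum.inr x), j (Sum.inr y)) ∈ glue j m1 m2 ↔ s(x, y) ∈ m2) ∧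
    (∀ x y, s(j (Sum.inl x), j (Sum.inr y)) ∉ glue j m1 m2) ∧
    (∀ x y, s(j (Sum.inr x), j (Sum.inl y)) ∉ glue j m1 m2) := by
  have i1 : Function.Injective (Sym2.map (fun x => j (Sum.inl x))) :=
    Sym2.map.injective (fun x y h => by simpa using h)
  have i2 : Function.Injective (Sym2.map (fun x => j (Sum.inr x))) :=
    Sym2.map.injective (fun x y h => by simpa using h)
  unfold glue
  refine ⟨fun x y => ?_, fun x y => ?_, fun x y => ?_, fun x y => ?_⟩
  · rw [Finset.mem_union]
    constructor
    · rintro (h | h)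
      · rw [← Sym2.map_mk (f := fun x => j (Sum.inl x)), i1.mem_finset_image] at h
        exact h
      · rw [Finset.mem_image] at h
        obtain ⟨e, -, he⟩ := h
        induction e using Sym2.ind with
        | _ u v => simp at he
    · intro h
      left
      exact Finset.mem_image_of_mem _ h
  · rw [Finset.mem_union]
    constructor
    · rintro (h | h)
      · rw [Finset.mem_image] at h
        obtain ⟨e, -, he⟩ := h
        induction e using Sym2.ind with
        | _ u v => simp at he
      · rw [← Sym2.map_mk (f := fun x => j (Sum.inr x)), i2.mem_finset_image] at h
        exact h
    · intro h
      right
      exact Finset.mem_image_of_mem _ h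
  all_goals
    rw [Finset.mem_union, Finset.mem_image, Finset.mem_image]
    rintro (⟨e, -, he⟩ | ⟨e, -, he⟩) <;>
    · induction e using Sym2.ind with
      | _ u v => simp at he

lemma gr_glue {f : Multigraph → ℝ} (hinv : GraphParam.Invariant f) (hadd : GraphParam.Additive f)
    (π : H → V) (π1 : H1 → V1) (π2 : H2 → V2) (j : H1 ⊕ H2 ≃ H) (e : V1 ⊕ V2 ≃ V)
    (h1 : ∀ x, π (j (Sum.inl x)) = e (Sum.inl (π1 x)))
    (h2 : ∀ x, π (j (Sum.inr x)) = e (Sum.inr (π2 x)))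
    (m1 : Finset (Sym2 H1)) (m2 : Finset (Sym2 H2)) :
    ph f π (glue j m1 m2) = ph f π1 m1 + ph f π2 m2 := by
  unfold ph
  rw [← hadd]
  symm
  refine hinv (Multigraph.disjUnion (gr π1 m1) (gr π2 m2)) (gr π (glue j m1 m2)) e ?_
  have i1 : Function.Injective (Sym2.map (fun x => j (Sum.inl x))) :=
    Sym2.map.injective (fun x y h => by simpa using h)
  have i2 : Function.Injective (Sym2.map (fun x => j (Sum.inr x))) :=
    Sym2.map.injective (fun x y h => by simpa using h)
  have hdis : Disjoint (m1.image (Sym2.map (fun x => j (Sum.inl x))))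
      (m2.image (Sym2.map (fun x => j (Sum.inr x)))) := by
    rw [Finset.disjoint_left]
    intro z hz1 hz2
    rw [Finset.mem_image] at hz1 hz2
    obtain ⟨e1, -, rfl⟩ := hz1
    obtain ⟨e2, -, he⟩ := hz2
    induction e1 using Sym2.ind with
    | _ u v =>
      induction e2 using Sym2.ind with
      | _ u' v' => simp at he
  have hval : (glue j m1 m2).val = m1.val.map (Sym2.map (fun x => j (Sum.inl x))) +
      m2.val.map (Sym2.map (fun x => j (Sum.inr x))) := by
    unfold glue
    rw [← Finset.disjUnion_eq_union _ _ hdis, Finset.disjUnion_val,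
      Finset.image_val_of_injOn i1.injOn, Finset.image_val_of_injOn i2.injOn]
  show (glue j m1 m2).val.map (Sym2.map π) =
    ((m1.val.map (Sym2.map π1)).map (Sym2.map Sum.inl) +
      (m2.val.map (Sym2.map π2)).map (Sym2.map Sum.inr)).map (Sym2.map e)
  rw [hval]
  simp only [Multiset.map_add, Multiset.map_map]
  congr 1
  · refine Multiset.map_congr rfl fun z _ => ?_
    induction z using Sym2.ind with
    | _ x y => simp [h1]
  · refine Multiset.map_congr rfl fun z _ => ?_
    induction z using Sym2.ind with
    | _ x y => simp [h2]

lemma FF_split {f : Multigraph → ℝ} (hinv : GraphParam.Invariant f) (hadd : GraphParam.Additive f)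
    (π : H → V) (π1 : H1 → V1) (π2 : H2 → V2) (j : H1 ⊕ H2 ≃ H) (e : V1 ⊕ V2 ≃ V)
    (h1 : ∀ x, π (j (Sum.inl x)) = e (Sum.inl (π1 x)))
    (h2 : ∀ x, π (j (Sum.inr x)) = e (Sum.inr (π2 x)))
    (A : H → Bool) (A1 : ∀ x, A (j (Sum.inl x)) = true) (A2 : ∀ x, A (j (Sum.inr x)) = false) :
    FF A (ph f π) (nA A true / 2) (nA A false / 2) 0 = avgMax f π1 + avgMax f π2 := by
  have hj : ∀ {C : H → Prop}, (∀ x, C x) ↔ (∀ x, C (j (Sum.inl x))) ∧ ∀ x, C (j (Sum.inr x)) := by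
    intro C
    rw [← Sum.forall (p := fun z => C (j z)), j.symm.forall_congr_left]
    simp
  let T := MM A (2 * (nA A true / 2)) (2 * (nA A false / 2)) 0
  let inv1 : Finset (Sym2 H) → Finset (Sym2 H1) := fun m =>
    univ.filter fun z => Sym2.map (fun x => j (Sum.inl x)) z ∈ m
  let inv2 : Finset (Sym2 H) → Finset (Sym2 H2) := fun m =>
    univ.filter fun z => Sym2.map (fun x => j (Sum.inr x)) z ∈ m
  have minv1 : ∀ m x y, s(x, y) ∈ inv1 m ↔ s(j (Sum.inl x), j (Sum.inl y)) ∈ m := by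
    intro m x y; simp [inv1]
  have minv2 : ∀ m x y, s(x, y) ∈ inv2 m ↔ s(j (Sum.inr x), j (Sum.inr y)) ∈ m := by
    intro m x y; simp [inv2]
  have fw : ∀ m1 ∈ mx H1, ∀ m2 ∈ mx H2, glue j m1 m2 ∈ T := by
    intro m1 hm1 m2 hm2
    rw [mem_mx, pm_iff] at hm1 hm2
    obtain ⟨g1, g2, g3, g4⟩ := mem_glue j m1 m2
    have hpm : IsPairMatching (glue j m1 m2) := by
      rw [pm_iff]
      constructor
      · simp only [hj, g1, g2, g3, g4, false_imp_iff, implies_true, true_and, and_true, ne_eq,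
          EmbeddingLike.apply_eq_iff_eq, Sum.inl.injEq, Sum.inr.injEq]
        exact ⟨hm1.1.1, hm2.1.1⟩
      · simp only [hj, g1, g2, g3, g4, false_imp_iff, implies_true, true_and, and_true, ne_eq,
          EmbeddingLike.apply_eq_iff_eq, Sum.inl.injEq, Sum.inr.injEq]
        exact ⟨hm1.1.2, hm2.1.2⟩
    have d0 : dcount A (glue j m1 m2) true false = 0 := by
      unfold dcount
      rw [Finset.card_eq_zero, Finset.filter_eq_empty_iff]
      rintro ⟨x, y⟩ -
      revert x y
      simp only [hj, g1, g2, g3, g4, A1, A2]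
      simp
    have u1 : (UU A (glue j m1 m2) true).card ≤ 1 := by
      rw [Finset.card_le_one]
      simp only [mem_UU, hj, A1, A2, Unm, g1, g2, g3, g4]
      simp
      exact fun x hx y hy => hm1.2 x y hx hy
    have u2 : (UU A (glue j m1 m2) false).card ≤ 1 := by
      rw [Finset.card_le_one]
      simp only [mem_UU, hj, A1, A2, Unm, g1, g2, g3, g4]
      simp
      exact fun x hx y hy => hm2.2 x y hx hy
    have c1 := card_UU A true _ hpm
    have c2 := card_UU A false _ hpm
    rw [dcount_symm A false true] at c2
    obtain ⟨p, hp⟩ := dcount_even A true _ hpm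
    obtain ⟨q, hq⟩ := dcount_even A false _ hpm
    rw [mem_MM]
    exact ⟨hpm, by omega, by omega, d0⟩
  have nocr : ∀ m ∈ T, ∀ x y, s(j (Sum.inl x), j (Sum.inr y)) ∉ m := by
    intro m hm x y hxy
    have d0 := ((mem_MM _ _ _ _ _).1 hm).2.2.2
    unfold dcount at d0
    rw [Finset.card_eq_zero, Finset.filter_eq_empty_iff] at d0
    exact d0 (Finset.mem_univ (j (Sum.inl x), j (Sum.inr y))) ⟨hxy, A1 x, A2 y⟩
  have nocr' : ∀ m ∈ T, ∀ x y, s(j (Sum.inr x), j (Sum.inl y)) ∉ m := by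
    intro m hm x y hxy
    rw [Sym2.eq_swap] at hxy
    exact nocr m hm y x hxy
  have bw : ∀ m ∈ T, inv1 m ∈ mx H1 ∧ inv2 m ∈ mx H2 := by
    intro m hm
    have n1 := nocr m hm
    have n2 := nocr' m hm
    have hU := UU_card_MM A hm
    have hpm := ((mem_MM _ _ _ _ _).1 hm).1
    rw [pm_iff] at hpm
    have u1 : (UU A m true).card ≤ 1 := by omega
    have u2 : (UU A m false).card ≤ 1 := by omega
    rw [Finset.card_le_one] at u1 u2
    have v1 : ∀ x, Unm (inv1 m) x → j (Sum.inl x) ∈ UU A m true := by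
      intro x hx
      rw [mem_UU]
      refine ⟨?_, A1 x⟩
      unfold Unm
      rw [hj]
      exact ⟨fun y hy => hx y ((minv1 _ _ _).2 hy), fun y => n1 x y⟩
    have v2 : ∀ x, Unm (inv2 m) x → j (Sum.inr x) ∈ UU A m false := by
      intro x hx
      rw [mem_UU]
      refine ⟨?_, A2 x⟩
      unfold Unm
      rw [hj]
      exact ⟨fun y => n2 x y, fun y hy => hx y ((minv2 _ _ _).2 hy)⟩
    constructor
    · rw [mem_mx, pm_iff]
      refine ⟨⟨?_, ?_⟩, ?_⟩
      · intro x y h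
        have := hpm.1 _ _ ((minv1 _ _ _).1 h)
        simpa using this
      · intro x y z h h'
        have := hpm.2 _ _ _ ((minv1 _ _ _).1 h) ((minv1 _ _ _).1 h')
        simpa using this
      · intro x y hx hy
        have := u1 _ (v1 x hx) _ (v1 y hy)
        simpa using this
    · rw [mem_mx, pm_iff]
      refine ⟨⟨?_, ?_⟩, ?_⟩
      · intro x y h
        have := hpm.1 _ _ ((minv2 _ _ _).1 h)
        simpa using this
      · intro x y z h h'
        have := hpm.2 _ _ _ ((minv2 _ _ _).1 h) ((minv2 _ _ _).1 h')
        simpa using this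
      · intro x y hx hy
        have := u2 _ (v2 x hx) _ (v2 y hy)
        simpa using this
  have li : ∀ m1 m2, inv1 (glue j m1 m2) = m1 ∧ inv2 (glue j m1 m2) = m2 := by
    intro m1 m2
    obtain ⟨g1, g2, g3, g4⟩ := mem_glue j m1 m2
    constructor
    · ext z
      induction z using Sym2.ind with
      | _ x y => rw [minv1, g1]
    · ext z
      induction z using Sym2.ind with
      | _ x y => rw [minv2, g2]
  have ri : ∀ m ∈ T, glue j (inv1 m) (inv2 m) = m := by
    intro m hm
    have n1 := nocr m hm
    have n2 := nocr' m hm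
    obtain ⟨g1, g2, g3, g4⟩ := mem_glue j (inv1 m) (inv2 m)
    ext z
    induction z using Sym2.ind with
    | _ x y =>
      revert x y
      simp only [hj, g1, g2, g3, g4, minv1, minv2, n1, n2, implies_true, and_self]
  have sumeq : ∀ ψ : Finset (Sym2 H) → ℝ, ∑ z ∈ mx H1 ×ˢ mx H2, ψ (glue j z.1 z.2) =
      ∑ m ∈ T, ψ m := by
    intro ψ
    refine Finset.sum_nbij' (fun z => glue j z.1 z.2) (fun m => (inv1 m, inv2 m)) ?_ ?_ ?_ ?_ ?_
    · intro z hz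
      rw [Finset.mem_product] at hz
      exact fw _ hz.1 _ hz.2
    · intro m hm
      rw [Finset.mem_product]
      exact bw m hm
    · intro z _
      exact Prod.ext (li z.1 z.2).1 (li z.1 z.2).2
    · intro m hm
      exact ri m hm
    · intro _ _
      rfl
  have hc1 : ((mx H1).card : ℝ) ≠ 0 := by
    exact_mod_cast (mx_nonempty H1).card_pos.ne'
  have hc2 : ((mx H2).card : ℝ) ≠ 0 := by
    exact_mod_cast (mx_nonempty H2).card_pos.ne'
  have s1 := sumeq (ph f π)
  have s2 := sumeq (fun _ => 1)
  simp only [Finset.sum_const, nsmul_eq_mul, mul_one, Finset.card_product] at s2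
  simp only [gr_glue hinv hadd π π1 π2 j e h1 h2, Finset.sum_product, Finset.sum_add_distrib,
    Finset.sum_const, nsmul_eq_mul] at s1
  rw [← Finset.mul_sum] at s1
  unfold FF avgMax
  show (∑ m ∈ T, ph f π m) / (T.card : ℝ) = _
  rw [← s1, ← s2]
  push_cast
  field_simp

end split

end Core3

section Core4

lemma kappa_nonneg {f : Multigraph → ℝ} {κ : ℝ} (hlip : GraphParam.Lipschitz f κ) : 0 ≤ κ :=
  (abs_nonneg _).trans (hlip { V := Unit, edges := 0 } () ())

lemma config_split_L {f : Multigraph → ℝ} {κ : ℝ}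
    (hinv : GraphParam.Invariant f) (hadd : GraphParam.Additive f)
    (hlip : GraphParam.Lipschitz f κ) (hconc : GraphParam.Concave f)
    (V : Type) [Fintype V] (d : V → ℕ) (S : V → Prop) (L N : ℕ) (hL : 4 ≤ L)
    (hN : ∑ i, d i = N) :
    configExpect {v // S v} (fun v => d v) f + configExpect {v // ¬ S v} (fun v => d v) f
      - κ * ((2 * L + 1) + 4 * N * N / (L * L) + N * (4 / L)) ≤ configExpect V d f := by
  have hκ := kappa_nonneg hlip
  rw [configExpect_eq, configExpect_eq, configExpect_eq]
  have hbij : Function.Bijective (Sum.elim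
      (fun x : HalfEdge {v // S v} (fun v => d v) => (⟨x.1.1, x.2⟩ : HalfEdge V d))
      (fun x : HalfEdge {v // ¬ S v} (fun v => d v) => (⟨x.1.1, x.2⟩ : HalfEdge V d))) := by
    constructor
    · rintro (⟨⟨a, ha⟩, s⟩ | ⟨⟨a, ha⟩, s⟩) (⟨⟨b, hb⟩, t⟩ | ⟨⟨b, hb⟩, t⟩) h
      · simp only [Sum.elim_inl, Sigma.mk.injEq] at h
        obtain ⟨h1, h2⟩ := h
        subst h1
        simp at h2
        subst h2
        rfl
      · simp only [Sum.elim_inl, Sum.elim_inr, Sigma.mk.injEq] at h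
        exact absurd (h.1 ▸ ha) hb
      · simp only [Sum.elim_inl, Sum.elim_inr, Sigma.mk.injEq] at h
        exact absurd (h.1 ▸ hb) ha
      · simp only [Sum.elim_inr, Sigma.mk.injEq] at h
        obtain ⟨h1, h2⟩ := h
        subst h1
        simp at h2
        subst h2
        rfl
    · rintro ⟨a, s⟩
      by_cases ha : S a
      · exact ⟨Sum.inl ⟨⟨a, ha⟩, s⟩, rfl⟩
      · exact ⟨Sum.inr ⟨⟨a, ha⟩, s⟩, rfl⟩
  let j := Equiv.ofBijective _ hbij
  let A : HalfEdge V d → Bool := fun h => decide (S h.1)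
  have hs := FF_split hinv hadd (Sigma.fst : HalfEdge V d → V)
    (Sigma.fst : HalfEdge {v // S v} (fun v => d v) → {v // S v})
    (Sigma.fst : HalfEdge {v // ¬ S v} (fun v => d v) → {v // ¬ S v}) j (Equiv.sumCompl S)
    (fun x => rfl) (fun x => rfl) A (fun x => by simp [A, j, x.1.2])
    (fun x => by simp [A, j, x.1.2])
  rw [← hs]
  have hNA : nA A true + nA A false = N := by
    have h1 : (univ : Finset (HalfEdge V d)).card = N := by
      rw [Finset.card_univ, Fintype.card_sigma]
      simpa using hN
    rw [← h1, nA, nA, ← Finset.card_filter_add_card_filter_not (s := univ) (fun x => A x = true)]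
    simp
  refine avgMax_ge f _ A _ ?_
  intro p q c ha hb ha' hb'
  have := FF_compare hκ hlip A (Sigma.fst : HalfEdge V d → V) hconc p q c L N (nA A true / 2)
    (nA A false / 2) hL ha hb ha' hb' hNA (by omega) (by omega) (by omega) (by omega)
  convert this using 1

lemma config_split {f : Multigraph → ℝ} {κ : ℝ}
    (hinv : GraphParam.Invariant f) (hadd : GraphParam.Additive f)
    (hlip : GraphParam.Lipschitz f κ) (hconc : GraphParam.Concave f)
    (V : Type) [Fintype V] (d : V → ℕ) (S : V → Prop) (δ : ℝ) (hδ : 0 < δ) :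
    configExpect {v // S v} (fun v => d v) f + configExpect {v // ¬ S v} (fun v => d v) f
      - κ * (2 * δ * ∑ i, (d i : ℝ) + (11 + 4 / δ ^ 2 + 4 / δ)) ≤ configExpect V d f := by
  have hκ := kappa_nonneg hlip
  set N := ∑ i, d i with hN
  have hNr : ∑ i, (d i : ℝ) = N := by rw [hN]; push_cast; rfl
  rw [hNr]
  set L := ⌈δ * N⌉₊ + 4 with hL
  have h := config_split_L hinv hadd hlip hconc V d S L N (by omega) hN.symm
  refine le_trans ?_ h
  have hN0 : (0 : ℝ) ≤ N := Nat.cast_nonneg _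
  have hL1 : δ * N ≤ L := by
    rw [hL]; push_cast
    have := Nat.le_ceil (δ * N)
    linarith
  have hL2 : (L : ℝ) ≤ δ * N + 5 := by
    rw [hL]; push_cast
    have := Nat.ceil_lt_add_one (mul_nonneg hδ.le hN0)
    linarith
  have hLpos : (0 : ℝ) < L := by rw [hL]; push_cast; positivity
  have hq : (N : ℝ) / L ≤ 1 / δ := by
    rw [div_le_div_iff₀ hLpos hδ]; linarith
  have hq0 : (0 : ℝ) ≤ N / L := by positivity
  have e1 : (4 : ℝ) * N * N / (L * L) = 4 * (N / L) ^ 2 := by field_simp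
  have e2 : (N : ℝ) * (4 / L) = 4 * (N / L) := by ring
  have e3 : (4 : ℝ) / δ ^ 2 = 4 * (1 / δ) ^ 2 := by field_simp
  have e4 : (4 : ℝ) / δ = 4 * (1 / δ) := by ring
  have hsq : ((N : ℝ) / L) ^ 2 ≤ (1 / δ) ^ 2 := by gcongr
  have : (2 * (L : ℝ) + 1) + 4 * N * N / (L * L) + N * (4 / L)
      ≤ 2 * δ * N + (11 + 4 / δ ^ 2 + 4 / δ) := by
    rw [e1, e2, e3, e4]; linarith
  have := mul_le_mul_of_nonneg_left this hκ
  linarith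

lemma config_reindex {f : Multigraph → ℝ} (hinv : GraphParam.Invariant f)
    (V V' : Type) [Fintype V] [DecidableEq V] [Fintype V'] [DecidableEq V'] (e : V ≃ V')
    (d : V → ℕ) (d' : V' → ℕ) (h : ∀ v, d' (e v) = d v) :
    configExpect V d f = configExpect V' d' f := by
  rw [configExpect_eq, configExpect_eq]
  refine avgMax_reindex hinv _ _ (Equiv.sigmaCongr e fun v => finCongr (h v).symm) e ?_
  intro x
  rfl

lemma ph_crude {H V : Type} [Fintype H] [Fintype V] {f : Multigraph → ℝ} {κ : ℝ}
    (hlip : GraphParam.Lipschitz f κ) (π : H → V) (m : Finset (Sym2 H)) :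
    |f (gr π m) - f (gr π ∅)| ≤ κ * m.card := by
  induction m using Finset.induction_on with
  | empty => simp
  | insert e m he ih =>
    induction e using Sym2.ind with
    | _ x y =>
      rw [gr_insert π he, Finset.card_insert_of_notMem he]
      have := hlip (gr π m) (π x) (π y)
      push_cast
      rw [abs_le] at *
      constructor <;> linarith [this.1, this.2, ih.1, ih.2]

lemma pm_card {H : Type} [Fintype H] {m : Finset (Sym2 H)} (hm : IsPairMatching m) :
    m.card ≤ Fintype.card H := by
  have : ∀ e : Sym2 H, ∃ x, x ∈ e := by
    intro e
    induction e using Sym2.ind with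
    | _ x y => exact ⟨x, Sym2.mem_mk_left x y⟩
  choose g hg using this
  rw [← Finset.card_univ]
  refine Finset.card_le_card_of_injOn g (fun _ _ => Finset.mem_coe.2 (Finset.mem_univ _)) ?_
  intro p hp q hq hpq
  by_contra hne
  exact hm.2 p hp q hq hne (g p) (hg p) (hpq ▸ hg q)

lemma config_crude {f : Multigraph → ℝ} {κ : ℝ}
    (hlip : GraphParam.Lipschitz f κ) (V : Type) [Fintype V] [DecidableEq V] (d : V → ℕ) :
    |configExpect V d f| ≤ |f { V := V, edges := 0 }| + κ * ∑ i, (d i : ℝ) := by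
  have hκ := kappa_nonneg hlip
  rw [configExpect_eq, avgMax]
  have hpos : (0 : ℝ) < ((mx (HalfEdge V d)).card : ℝ) := by
    exact_mod_cast (mx_nonempty _).card_pos
  rw [abs_div, abs_of_pos hpos, div_le_iff₀ hpos]
  refine (Finset.abs_sum_le_sum_abs _ _).trans ?_
  rw [mul_comm, ← nsmul_eq_mul]
  refine Finset.sum_le_card_nsmul _ _ _ ?_
  intro m hm
  have hpm := (mem_mx.1 hm).1
  have h1 := ph_crude hlip (Sigma.fst : HalfEdge V d → V) m
  have h2 : (m.card : ℝ) ≤ ∑ i, (d i : ℝ) := by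
    have := pm_card hpm
    rw [Fintype.card_sigma] at this
    simp only [Fintype.card_fin] at this
    exact_mod_cast this
  have h3 := mul_le_mul_of_nonneg_left h2 hκ
  have h4 := abs_sub_abs_le_abs_sub (f (gr (Sigma.fst : HalfEdge V d → V) m))
    (f (gr (Sigma.fst : HalfEdge V d → V) ∅))
  have h5 : gr (Sigma.fst : HalfEdge V d → V) ∅ = { V := V, edges := 0 } := by simp [gr]
  rw [h5] at h1 h4
  unfold ph
  linarith

end Core4

section Core5

/-- A probability distribution on `ℕ` with finite mean. -/
structure DegLaw where
  p : ℕ → ℝ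
  nonneg : ∀ k, 0 ≤ p k
  one : HasSum p 1
  mean : Summable fun k : ℕ => (k : ℝ) * p k

noncomputable def DegLaw.nu (a : DegLaw) : Measure ℕ :=
  Measure.sum fun k => ENNReal.ofReal (a.p k) • Measure.dirac k

lemma DegLaw.nu_singleton (a : DegLaw) (k : ℕ) : a.nu {k} = ENNReal.ofReal (a.p k) := by
  rw [DegLaw.nu, Measure.sum_apply _ (measurableSet_singleton k), tsum_eq_single k]
  · simp
  · intro j hj
    simp [hj]

instance (a : DegLaw) : IsProbabilityMeasure a.nu := by
  constructor
  rw [DegLaw.nu, Measure.sum_apply _ MeasurableSet.univ]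
  simp only [Measure.smul_apply, measure_univ, smul_eq_mul, mul_one]
  rw [← ENNReal.ofReal_tsum_of_nonneg a.nonneg a.one.summable, a.one.tsum_eq]
  simp

lemma DegLaw.integrable_id (a : DegLaw) : Integrable (fun k : ℕ => (k : ℝ)) a.nu := by
  refine integrable_sum_dirac (fun _ => ENNReal.ofReal_ne_top) ?_
  refine a.mean.congr fun k => ?_
  rw [ENNReal.toReal_ofReal (a.nonneg k)]
  simp [mul_comm]

noncomputable def DegLaw.mn (a : DegLaw) : ℝ := ∫ k, (k : ℝ) ∂a.nu

lemma DegLaw.mn_nonneg (a : DegLaw) : 0 ≤ a.mn := integral_nonneg fun k => Nat.cast_nonneg k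

noncomputable def PI {V : Type} [Fintype V] (ρ : V → DegLaw) : Measure (V → ℕ) :=
  Measure.pi fun v => (ρ v).nu

instance {V : Type} [Fintype V] (ρ : V → DegLaw) : IsProbabilityMeasure (PI ρ) := by
  unfold PI; infer_instance

variable {V : Type} [Fintype V]

lemma PI_hasSum (ρ : V → DegLaw) (g : (V → ℕ) → ℝ) (hg : Integrable g (PI ρ)) :
    HasSum (fun D => (∏ v, (ρ v).p (D v)) * g D) (∫ D, g D ∂PI ρ) := by
  have h1 := Measure.sum_smul_dirac (PI ρ)
  rw [← h1] at hg
  have h2 := hasSum_integral_measure hg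
  rw [h1] at h2
  have h3 : (fun D => (∏ v, (ρ v).p (D v)) * g D) =
      fun i => ∫ x, g x ∂((PI ρ) {i} • Measure.dirac i) := ?_
  · rw [h3]; exact h2
  funext D
  rw [integral_smul_measure, integral_dirac, smul_eq_mul, PI, Measure.pi_singleton,
    ENNReal.toReal_prod]
  congr 1
  refine Finset.prod_congr rfl fun v _ => ?_
  rw [DegLaw.nu_singleton, ENNReal.toReal_ofReal ((ρ v).nonneg _)]

lemma PI_coord (ρ : V → DegLaw) (v : V) : Integrable (fun D : V → ℕ => (D v : ℝ)) (PI ρ) :=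
  ((measurePreserving_eval (fun v => (ρ v).nu) v).integrable_comp
    (Measurable.of_discrete.aestronglyMeasurable)).2 (ρ v).integrable_id

lemma PI_sum_integrable (ρ : V → DegLaw) :
    Integrable (fun D : V → ℕ => ∑ v, (D v : ℝ)) (PI ρ) :=
  integrable_finsetSum _ fun v _ => PI_coord ρ v

lemma PI_sum (ρ : V → DegLaw) : ∫ D, (∑ v, (D v : ℝ)) ∂PI ρ = ∑ v, (ρ v).mn := by
  rw [integral_finsetSum _ fun v _ => PI_coord ρ v]
  refine Finset.sum_congr rfl fun v _ => ?_
  have h := measurePreserving_eval (fun v => (ρ v).nu) v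
  rw [DegLaw.mn, ← h.map_eq, integral_map h.measurable.aemeasurable
    (Measurable.of_discrete.aestronglyMeasurable)]
  rfl

lemma PI_config {f : Multigraph → ℝ} {κ : ℝ} (hlip : GraphParam.Lipschitz f κ) [DecidableEq V]
    (ρ : V → DegLaw) : Integrable (fun D : V → ℕ => configExpect V D f) (PI ρ) := by
  refine Integrable.mono' (g := fun D => |f { V := V, edges := 0 }| + κ * ∑ i, (D i : ℝ)) ?_
    (Measurable.of_discrete.aestronglyMeasurable) ?_
  · exact (integrable_const _).add ((PI_sum_integrable ρ).const_mul κ)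
  · exact Filter.Eventually.of_forall fun D => config_crude hlip V D

lemma PI_restrict (ρ : V → DegLaw) (S : V → Prop) [DecidablePred S] :
    MeasurePreserving (fun (D : V → ℕ) (v : {v // S v}) => D v) (PI ρ)
      (PI fun v : {v // S v} => ρ v) :=
  measurePreserving_fst.comp (measurePreserving_piEquivPiSubtypeProd (fun v => (ρ v).nu) S)

lemma PI_const {f : Multigraph → ℝ} {κ : ℝ} (hinv : GraphParam.Invariant f)
    (hlip : GraphParam.Lipschitz f κ) [DecidableEq V] (a : DegLaw) (n : ℕ)
    (hn : Fintype.card V = n) :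
    ∫ D, configExpect V D f ∂PI (fun _ : V => a) = iidExpect a.p n f := by
  have e : Fin n ≃ V := (Fintype.equivFinOfCardEq hn).symm
  have h1 := (PI_hasSum (fun _ : Fin n => a) _ (PI_config hlip _)).tsum_eq
  rw [iidExpect, h1]
  have h2 := measurePreserving_piCongrLeft (fun _ : V => a.nu) e
  have h3 := h2.integral_comp' (fun D => configExpect V D f)
  refine h3.symm.trans ?_
  refine integral_congr_ae (Filter.Eventually.of_forall fun D => ?_)
  refine (config_reindex hinv _ _ e _ _ ?_).symm
  intro v
  simp [MeasurableEquiv.piCongrLeft, Equiv.piCongrLeft_apply_apply]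

lemma PI_split {f : Multigraph → ℝ} {κ : ℝ}
    (hinv : GraphParam.Invariant f) (hadd : GraphParam.Additive f)
    (hlip : GraphParam.Lipschitz f κ) (hconc : GraphParam.Concave f)
    (S : V → Prop) (k k' : ℕ)
    (hk : Fintype.card {v // S v} = k) (hk' : Fintype.card {v // ¬ S v} = k') (a b : DegLaw) (δ : ℝ) (hδ : 0 < δ) :
    iidExpect a.p k f + iidExpect b.p k' f
      - κ * (2 * δ * (Fintype.card V * (a.mn + b.mn)) + (11 + 4 / δ ^ 2 + 4 / δ)) ≤
    ∫ D, configExpect V D f ∂PI (fun v => if S v then a else b) := by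
  have hκ := kappa_nonneg hlip
  set ρ : V → DegLaw := fun v => if S v then a else b with hρ
  have i1 : ∫ D, configExpect {v // S v} (fun v => D v) f ∂PI ρ = iidExpect a.p k f := by
    have h := PI_restrict ρ S
    rw [← PI_const hinv hlip (V := {v // S v}) a k hk]
    have : (fun v : {v // S v} => ρ v) = fun _ => a := by
      funext v; simp [hρ, v.2]
    rw [← this, ← h.map_eq, integral_map h.measurable.aemeasurable
      (Measurable.of_discrete.aestronglyMeasurable)]
  have i2 : ∫ D, configExpect {v // ¬ S v} (fun v => D v) f ∂PI ρ
      = iidExpect b.p k' f := by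
    have h := PI_restrict ρ (fun v => ¬ S v)
    rw [← PI_const hinv hlip (V := {v // ¬ S v}) b k' hk']
    have : (fun v : {v // ¬ S v} => ρ v) = fun _ => b := by
      funext v; simp [hρ, v.2]
    rw [← this, ← h.map_eq, integral_map h.measurable.aemeasurable
      (Measurable.of_discrete.aestronglyMeasurable)]
  have g1 : Integrable (fun D : V → ℕ => configExpect {v // S v} (fun v => D v) f) (PI ρ) :=
    ((PI_restrict ρ S).integrable_comp
      (Measurable.of_discrete.aestronglyMeasurable)).2 (PI_config hlip _)
  have g2 : Integrable (fun D : V → ℕ => configExpect {v // ¬ S v} (fun v => D v) f) (PI ρ) :=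
    ((PI_restrict ρ (fun v => ¬ S v)).integrable_comp
      (Measurable.of_discrete.aestronglyMeasurable)).2 (PI_config hlip _)
  have g3 : Integrable (fun D : V → ℕ => κ * (2 * δ * ∑ i, (D i : ℝ) +
      (11 + 4 / δ ^ 2 + 4 / δ))) (PI ρ) :=
    (((PI_sum_integrable ρ).const_mul _).add (integrable_const _)).const_mul _
  have i3 : ∫ D, κ * (2 * δ * ∑ i, (D i : ℝ) + (11 + 4 / δ ^ 2 + 4 / δ)) ∂PI ρ ≤
      κ * (2 * δ * (Fintype.card V * (a.mn + b.mn)) + (11 + 4 / δ ^ 2 + 4 / δ)) := by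
    rw [integral_const_mul, integral_add ((PI_sum_integrable ρ).const_mul _) (integrable_const _),
      integral_const_mul, PI_sum, integral_const]
    have : ∑ v, (ρ v).mn ≤ Fintype.card V * (a.mn + b.mn) := by
      rw [← nsmul_eq_mul, ← Finset.card_univ]
      refine Finset.sum_le_card_nsmul _ _ _ fun v _ => ?_
      have := a.mn_nonneg
      have := b.mn_nonneg
      simp only [hρ]
      split_ifs <;> linarith
    simp only [probReal_univ, one_smul]
    gcongr
  have key := integral_mono (μ := PI ρ) ((g1.add g2).sub g3) (PI_config hlip ρ)
    (fun D => by
      have := config_split hinv hadd hlip hconc V D S δ hδ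
      simp only [Pi.sub_apply, Pi.add_apply]
      convert this using 1)
  rw [integral_sub' (g1.add g2) g3, integral_add' g1 g2, i1, i2] at key
  linarith

/-- Mixture of two distributions. -/
noncomputable def DegLaw.mix (a b : DegLaw) (θ : ℝ) (h0 : 0 ≤ θ) (h1 : θ ≤ 1) : DegLaw where
  p k := θ * a.p k + (1 - θ) * b.p k
  nonneg k := add_nonneg (mul_nonneg h0 (a.nonneg k)) (mul_nonneg (by linarith) (b.nonneg k))
  one := by
    have := (a.one.mul_left θ).add (b.one.mul_left (1 - θ))
    simpa using this
  mean := by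
    refine ((a.mean.mul_left θ).add (b.mean.mul_left (1 - θ))).congr fun k => ?_
    ring

lemma mix_expand {f : Multigraph → ℝ} {κ : ℝ} (hlip : GraphParam.Lipschitz f κ) (n : ℕ)
    (a b : DegLaw) (θ : ℝ) :
    iidExpect (fun k => θ * a.p k + (1 - θ) * b.p k) n f =
      ∑ S : Finset (Fin n), θ ^ S.card * (1 - θ) ^ (n - S.card) *
        ∫ D, configExpect (Fin n) D f ∂PI (fun v => if v ∈ S then a else b) := by
  have h : ∀ S : Finset (Fin n), HasSum
      (fun D : Fin n → ℕ => θ ^ S.card * (1 - θ) ^ (n - S.card) *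
        ((∏ v, (if v ∈ S then a else b).p (D v)) * configExpect (Fin n) D f))
      (θ ^ S.card * (1 - θ) ^ (n - S.card) *
        ∫ D, configExpect (Fin n) D f ∂PI (fun v => if v ∈ S then a else b)) := fun S =>
    (PI_hasSum (fun v => if v ∈ S then a else b) _ (PI_config hlip _)).mul_left _
  have h2 := hasSum_sum (s := Finset.univ) (fun S _ => h S)
  rw [← h2.tsum_eq, iidExpect]
  refine tsum_congr fun D => ?_
  rw [Finset.prod_add, Finset.powerset_univ, Finset.sum_mul]
  refine Finset.sum_congr rfl fun S _ => ?_
  have e1 : ∏ v, (if v ∈ S then a else b).p (D v)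
      = (∏ v ∈ S, a.p (D v)) * ∏ v ∈ univ \ S, b.p (D v) := by
    rw [← Finset.prod_sdiff (Finset.subset_univ S), mul_comm]
    congr 1
    · exact Finset.prod_congr rfl fun v hv => by simp [hv]
    · exact Finset.prod_congr rfl fun v hv => by
        simp only [Finset.mem_sdiff, Finset.mem_univ, true_and] at hv
        simp [hv]
  rw [e1, Finset.prod_mul_distrib, Finset.prod_mul_distrib, Finset.prod_const, Finset.prod_const,
    Finset.card_sdiff_of_subset (Finset.subset_univ S), Finset.card_univ, Fintype.card_fin]
  ring

end Core5

section Core6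

lemma sum_w (θ : ℝ) (n : ℕ) :
    ∑ S : Finset (Fin n), θ ^ S.card * (1 - θ) ^ (n - S.card) = 1 := by
  have := Fintype.sum_pow_mul_eq_add_pow (Fin n) θ (1 - θ)
  simpa using this

lemma sum_w_card (θ : ℝ) (n : ℕ) :
    ∑ S : Finset (Fin n), θ ^ S.card * (1 - θ) ^ (n - S.card) * (S.card : ℝ) = θ * n := by
  have h1 := Finset.sum_powerset_apply_card (x := (univ : Finset (Fin n)))
    (fun k => θ ^ k * (1 - θ) ^ (n - k) * (k : ℝ))
  rw [Finset.powerset_univ] at h1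
  rw [h1, Finset.card_univ, Fintype.card_fin]
  have h2 := congrArg (Polynomial.eval θ) (bernsteinPolynomial.sum_smul ℝ n)
  rw [Polynomial.eval_finsetSum] at h2
  simp only [bernsteinPolynomial, nsmul_eq_mul, Polynomial.eval_mul, Polynomial.eval_natCast,
    Polynomial.eval_pow, Polynomial.eval_X, Polynomial.eval_sub, Polynomial.eval_one] at h2
  rw [mul_comm θ, ← h2]
  refine Finset.sum_congr rfl fun k _ => ?_
  rw [nsmul_eq_mul]
  ring

lemma lin_lower (u : ℕ → ℝ) (Ψ ε : ℝ) (hε : 0 < ε)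
    (h : Tendsto (fun n => u n / (n : ℝ)) atTop (nhds Ψ)) :
    ∃ C : ℝ, ∀ k, (Ψ - ε) * k - C ≤ u k := by
  have h1 : ∀ᶠ n in atTop, Ψ - ε < u n / (n : ℝ) := h.eventually_const_lt (by linarith)
  obtain ⟨K, hK⟩ := (h1.and (eventually_gt_atTop 0)).exists_forall_of_atTop
  refine ⟨∑ k ∈ range K, |(Ψ - ε) * k - u k|, fun k => ?_⟩
  have hs : 0 ≤ ∑ k ∈ range K, |(Ψ - ε) * k - u k| := Finset.sum_nonneg fun _ _ => abs_nonneg _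
  by_cases hk : k < K
  · have := Finset.single_le_sum (f := fun k : ℕ => |(Ψ - ε) * k - u k|)
      (fun _ _ => abs_nonneg _) (Finset.mem_range.2 hk)
    have h3 := le_abs_self ((Ψ - ε) * k - u k)
    linarith
  · obtain ⟨h3, h4⟩ := hK k (by omega)
    rw [lt_div_iff₀ (by exact_mod_cast h4)] at h3
    linarith

lemma mix_bound {f : Multigraph → ℝ} {κ : ℝ}
    (hinv : GraphParam.Invariant f) (hadd : GraphParam.Additive f)
    (hlip : GraphParam.Lipschitz f κ) (hconc : GraphParam.Concave f)
    (a b : DegLaw) (θ : ℝ) (h0 : 0 ≤ θ) (h1 : θ ≤ 1) (δ : ℝ) (hδ : 0 < δ) (α β C₁ C₂ : ℝ)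
    (hα : ∀ k : ℕ, α * k - C₁ ≤ iidExpect a.p k f) (hβ : ∀ k : ℕ, β * k - C₂ ≤ iidExpect b.p k f)
    (n : ℕ) :
    (α * θ + β * (1 - θ)) * n - C₁ - C₂
      - κ * (2 * δ * (n * (a.mn + b.mn)) + (11 + 4 / δ ^ 2 + 4 / δ)) ≤
    iidExpect (fun k => θ * a.p k + (1 - θ) * b.p k) n f := by
  rw [mix_expand hlip]
  set E := κ * (2 * δ * (n * (a.mn + b.mn)) + (11 + 4 / δ ^ 2 + 4 / δ)) with hE
  have key : ∀ S : Finset (Fin n), (α - β) * S.card + (β * n - C₁ - C₂ - E) ≤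
      ∫ D, configExpect (Fin n) D f ∂PI (fun v => if v ∈ S then a else b) := by
    intro S
    have hc : S.card ≤ n := by simpa using Finset.card_le_univ S
    have := PI_split hinv hadd hlip hconc (fun v => v ∈ S) S.card (n - S.card)
      (by rw [Fintype.card_subtype]; simp)
      (by rw [Fintype.card_subtype_compl, Fintype.card_subtype]; simp) a b δ hδ
    rw [Fintype.card_fin, ← hE] at this
    have e1 := hα S.card
    have e2 := hβ (n - S.card)
    rw [Nat.cast_sub hc] at e2
    refine le_trans ?_ (this.trans (le_of_eq ?_))
    · linarith
    · congr! 2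
      funext v
      congr
  have hw : ∀ S : Finset (Fin n), 0 ≤ θ ^ S.card * (1 - θ) ^ (n - S.card) := fun S =>
    mul_nonneg (pow_nonneg h0 _) (pow_nonneg (by linarith) _)
  refine le_trans (le_of_eq ?_) (Finset.sum_le_sum fun S _ =>
    mul_le_mul_of_nonneg_left (key S) (hw S))
  have : ∀ S : Finset (Fin n), θ ^ S.card * (1 - θ) ^ (n - S.card) *
      ((α - β) * S.card + (β * n - C₁ - C₂ - E)) =
      (α - β) * (θ ^ S.card * (1 - θ) ^ (n - S.card) * S.card) +
      (β * n - C₁ - C₂ - E) * (θ ^ S.card * (1 - θ) ^ (n - S.card)) := fun S => by ring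
  simp only [this]
  rw [Finset.sum_add_distrib, ← Finset.mul_sum, ← Finset.mul_sum, sum_w, sum_w_card]
  ring

lemma final {f : Multigraph → ℝ} {κ : ℝ}
    (hinv : GraphParam.Invariant f) (hadd : GraphParam.Additive f)
    (hlip : GraphParam.Lipschitz f κ) (hconc : GraphParam.Concave f)
    (a b : DegLaw) (θ : ℝ) (h0 : 0 ≤ θ) (h1 : θ ≤ 1) (Ψμ Ψμ' Ψmix : ℝ)
    (hΨμ : Tendsto (fun n => iidExpect a.p n f / (n : ℝ)) atTop (nhds Ψμ))
    (hΨμ' : Tendsto (fun n => iidExpect b.p n f / (n : ℝ)) atTop (nhds Ψμ'))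
    (hΨmix : Tendsto (fun n => iidExpect (fun k => θ * a.p k + (1 - θ) * b.p k) n f / (n : ℝ))
      atTop (nhds Ψmix)) :
    θ * Ψμ + (1 - θ) * Ψμ' ≤ Ψmix := by
  have hκ := kappa_nonneg hlip
  have hm1 := a.mn_nonneg
  have hm2 := b.mn_nonneg
  set M := 1 + 2 * κ * (a.mn + b.mn) with hM
  have hMpos : 0 < M := by positivity
  refine le_of_forall_pos_le_add fun ε hε => ?_
  set δ := ε / M with hδ
  have hδ0 : 0 < δ := by positivity
  obtain ⟨C₁, hC₁⟩ := lin_lower _ _ δ hδ0 hΨμ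
  obtain ⟨C₂, hC₂⟩ := lin_lower _ _ δ hδ0 hΨμ'
  have hb := mix_bound hinv hadd hlip hconc a b θ h0 h1 δ hδ0 _ _ C₁ C₂ hC₁ hC₂
  set C := C₁ + C₂ + κ * (11 + 4 / δ ^ 2 + 4 / δ) with hC
  have hlim : Tendsto (fun n : ℕ => (θ * Ψμ + (1 - θ) * Ψμ' - ε) - C / (n : ℝ)) atTop
      (nhds ((θ * Ψμ + (1 - θ) * Ψμ' - ε) - 0)) :=
    tendsto_const_nhds.sub (tendsto_const_div_atTop_nhds_zero_nat C)
  have hle := le_of_tendsto_of_tendsto hlim hΨmix (by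
    filter_upwards [eventually_gt_atTop 0] with n hn
    have hn' : (0 : ℝ) < n := by exact_mod_cast hn
    have h3 := hb n
    rw [le_div_iff₀ hn', sub_mul, div_mul_cancel₀ _ hn'.ne']
    have h4 : ε = δ * (1 + 2 * κ * (a.mn + b.mn)) := by
      rw [← hM, hδ]; field_simp
    refine le_trans (le_of_eq ?_) h3
    rw [hC, h4]
    ring)
  linarith

end Core6

theorem statement2 (f : Multigraph → ℝ) (κ : ℝ)
    (hinv : GraphParam.Invariant f) (hadd : GraphParam.Additive f)
    (hlip : GraphParam.Lipschitz f κ) (hconc : GraphParam.Concave f)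
    (μ μ' : ℕ → ℝ)
    (hμ0 : ∀ k, 0 ≤ μ k) (hμ1 : HasSum μ 1) (hμmean : Summable fun k : ℕ => (k : ℝ) * μ k)
    (hμ'0 : ∀ k, 0 ≤ μ' k) (hμ'1 : HasSum μ' 1) (hμ'mean : Summable fun k : ℕ => (k : ℝ) * μ' k)
    (θ : ℝ) (hθ0 : 0 ≤ θ) (hθ1 : θ ≤ 1)
    (Ψμ Ψμ' Ψmix : ℝ)
    (hΨμ : Tendsto (fun n => iidExpect μ n f / (n : ℝ)) atTop (nhds Ψμ))
    (hΨμ' : Tendsto (fun n => iidExpect μ' n f / (n : ℝ)) atTop (nhds Ψμ'))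
    (hΨmix : Tendsto (fun n => iidExpect (fun k => θ * μ k + (1 - θ) * μ' k) n f / (n : ℝ))
      atTop (nhds Ψmix)) :
    θ * Ψμ + (1 - θ) * Ψμ' ≤ Ψmix := by
  exact final hinv hadd hlip hconc ⟨μ, hμ0, hμ1, hμmean⟩ ⟨μ', hμ'0, hμ'1, hμ'mean⟩ θ hθ0 hθ1
    Ψμ Ψμ' Ψmix hΨμ hΨμ' hΨmix
end

section
/- Let 𝔣 be an additive, κ-Lipschitz, concave graph parameter, let A and B be finite disjoint sets, and let d : A ∪ B → ℕ. Writing d↾A and d↾B for the restrictions of d to A and B, one has E[𝔣(𝔾_{d↾A})] + E[𝔣(𝔾_{d↾B})] ≤ E[𝔣(𝔾_d)] + φ((1/2)·Σ_{i∈A∪B} d(i)), where φ(x) = 7κ·√(x·ln(1+x)). -/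
open Finset Filter Topology MeasureTheory
open scoped Classical BigOperators ENNReal

/-- The multiset of endpoints of a multiset of pairs. -/
def ends {α : Type} (P : Multiset (Sym2 α)) : Multiset α := P.bind Sym2.toMultiset

lemma toMultiset_mk' {α : Type} (h k : α) : (s(h, k)).toMultiset = {h, k} := rfl

lemma ends_zero {α : Type} : ends (0 : Multiset (Sym2 α)) = 0 := by simp [ends]

lemma ends_cons {α : Type} (h k : α) (P : Multiset (Sym2 α)) :
    ends (s(h, k) ::ₘ P) = h ::ₘ k ::ₘ ends P := by
  simp [ends, Multiset.cons_bind, toMultiset_mk', Multiset.insert_eq_cons]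

lemma ends_add {α : Type} (P Q : Multiset (Sym2 α)) : ends (P + Q) = ends P + ends Q := by
  simp [ends]

lemma ends_map {α β : Type} (g : α → β) (P : Multiset (Sym2 α)) :
    ends (P.map (Sym2.map g)) = (ends P).map g := by
  induction P using Multiset.induction_on with
  | empty => simp [ends]
  | cons e P ih =>
    induction e using Sym2.ind with
    | _ h k => simp [ends_cons, ih]

lemma card_ends {α : Type} (P : Multiset (Sym2 α)) : (ends P).card = 2 * P.card := by
  simp [ends, Multiset.card_bind, Sym2.card_toMultiset, mul_comm]

lemma exists_fun_of_map_eq {α : Type} (c : α → Bool) (U : Multiset α) :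
    ∀ U' : Multiset α, U.Nodup → U.map c = U'.map c →
      ∃ π : α → α, (∀ x ∈ U, c (π x) = c x) ∧ U.map π = U' := by
  induction U using Multiset.induction_on with
  | empty =>
    intro U' _ h
    refine ⟨id, by simp, ?_⟩
    have : U'.map c = 0 := by simpa using h.symm
    simpa using (Multiset.map_eq_zero.1 this).symm
  | cons a U ih =>
    intro U' hn h
    rw [Multiset.map_cons] at h
    obtain ⟨b, hb, hcb, hU⟩ := (Multiset.map_eq_cons _ _ _ _).2 h.symm
    obtain ⟨ha, hn'⟩ := Multiset.nodup_cons.1 hn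
    obtain ⟨π, h1, h2⟩ := ih _ hn' hU.symm
    refine ⟨Function.update π a b, ?_, ?_⟩
    · intro x hx
      by_cases hxa : x = a
      · subst hxa; simp [hcb]
      · rw [Function.update_of_ne hxa]
        exact h1 x ((Multiset.mem_cons.1 hx).resolve_left hxa)
    · rw [Multiset.map_cons, Function.update_self, ← Multiset.cons_erase hb, ← h2]
      congr 1
      apply Multiset.map_congr rfl
      intro x hx
      rw [Function.update_of_ne]
      rintro rfl; exact ha hx

lemma sym2_map_congr' {α β : Type} {g g' : α → β} (P : Multiset (Sym2 α))
    (h : ∀ x ∈ ends P, g x = g' x) : P.map (Sym2.map g) = P.map (Sym2.map g') := by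
  apply Multiset.map_congr rfl
  intro e he
  induction e using Sym2.ind with
  | _ a b =>
    have h1 : g a = g' a := h a (by
      simp only [ends, Multiset.mem_bind]; exact ⟨_, he, by simp⟩)
    have h2 : g b = g' b := h b (by
      simp only [ends, Multiset.mem_bind]; exact ⟨_, he, by simp⟩)
    simp [h1, h2]

lemma exists_fun_of_types_eq {α : Type} (c : α → Bool) (P : Multiset (Sym2 α)) :
    ∀ (P' : Multiset (Sym2 α)) (U U' : Multiset α), (ends P + U).Nodup →
      P.map (Sym2.map c) = P'.map (Sym2.map c) → U.map c = U'.map c →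
      ∃ π : α → α, (∀ x ∈ ends P + U, c (π x) = c x) ∧ P.map (Sym2.map π) = P' ∧
        U.map π = U' := by
  induction P using Multiset.induction_on with
  | empty =>
    intro P' U U' hn h hU
    have : P'.map (Sym2.map c) = 0 := by simpa using h.symm
    rw [Multiset.map_eq_zero.1 this]
    simp only [ends_zero, zero_add] at hn ⊢
    obtain ⟨π, h1, h2⟩ := exists_fun_of_map_eq c U U' hn hU
    exact ⟨π, h1, by simp, h2⟩
  | cons e P ih =>
    intro P' U U' hn h hU
    rw [Multiset.map_cons] at h
    obtain ⟨e', he', hce, hP⟩ := (Multiset.map_eq_cons _ _ _ _).2 h.symm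
    clear h
    obtain ⟨h, k, h', k', rfl, rfl, hch, hck⟩ : ∃ h k h' k', e = s(h, k) ∧ e' = s(h', k') ∧
        c h' = c h ∧ c k' = c k := by
      induction e using Sym2.ind with
      | _ h k =>
        induction e' using Sym2.ind with
        | _ h' k' =>
          simp only [Sym2.map_mk, Sym2.eq_iff] at hce
          rcases hce with ⟨h1, h2⟩ | ⟨h1, h2⟩
          · exact ⟨h, k, h', k', rfl, rfl, h1, h2⟩
          · exact ⟨h, k, k', h', rfl, Sym2.eq_swap, h2, h1⟩
    rw [ends_cons, Multiset.cons_add, Multiset.cons_add] at hn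
    obtain ⟨hn1, hn2⟩ := Multiset.nodup_cons.1 hn
    obtain ⟨hn3, hn4⟩ := Multiset.nodup_cons.1 hn2
    have hhk : h ≠ k := fun hh => hn1 (by simp [hh])
    have hn1' : h ∉ ends P + U := fun hh => hn1 (Multiset.mem_cons_of_mem hh)
    obtain ⟨π, h1, h2, h3⟩ := ih _ U U' hn4 hP.symm hU
    set π' := Function.update (Function.update π h h') k k' with hπ'
    have e1 : ∀ x ∈ ends P + U, π' x = π x := by
      intro x hx
      rw [hπ', Function.update_of_ne (by rintro rfl; exact hn3 hx),
        Function.update_of_ne (by rintro rfl; exact hn1' hx)]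
    have e2 : π' h = h' := by simp [hπ', Function.update_of_ne hhk]
    have e3 : π' k = k' := by simp [hπ']
    refine ⟨π', ?_, ?_, ?_⟩
    · intro x hx
      rw [ends_cons, Multiset.cons_add, Multiset.cons_add, Multiset.mem_cons,
        Multiset.mem_cons] at hx
      rcases hx with rfl | rfl | hx
      · rw [e2, hch]
      · rw [e3, hck]
      · rw [e1 x hx, h1 x hx]
    · rw [Multiset.map_cons, Sym2.map_mk, e2, e3, ← Multiset.cons_erase he', ← h2]
      congr 1
      exact sym2_map_congr' _ fun x hx => e1 x (Multiset.mem_add.2 (Or.inl hx))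
    · rw [← h3]
      exact Multiset.map_congr rfl fun x hx => e1 x (Multiset.mem_add.2 (Or.inr hx))

/-- `P` is a matching of the finite type `α` with set of unmatched elements `U`. -/
def Mt {α : Type} [Fintype α] (P : Multiset (Sym2 α)) (U : Multiset α) : Prop :=
  ends P + U = (Finset.univ : Finset α).val

lemma Mt.nodup {α : Type} [Fintype α] {P : Multiset (Sym2 α)} {U : Multiset α} (h : Mt P U) :
    (ends P + U).Nodup := by
  rw [Mt] at h; rw [h]; exact Finset.univ.nodup

lemma Mt.card {α : Type} [Fintype α] {P : Multiset (Sym2 α)} {U : Multiset α} (h : Mt P U) :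
    2 * P.card + U.card = Fintype.card α := by
  have := congrArg Multiset.card h
  rw [Multiset.card_add, card_ends] at this
  simpa using this

lemma Mt.exists_perm {α : Type} [Fintype α] (c : α → Bool) {P P' : Multiset (Sym2 α)}
    {U U' : Multiset α} (h : Mt P U) (h' : Mt P' U')
    (hP : P.map (Sym2.map c) = P'.map (Sym2.map c)) :
    ∃ π : Equiv.Perm α, (∀ x, c (π x) = c x) ∧ P.map (Sym2.map π) = P' := by
  have hU : U.map c = U'.map c := by
    have e1 := congrArg (Multiset.map c) (h.trans h'.symm)
    rw [Multiset.map_add, Multiset.map_add, ← ends_map, ← ends_map, hP] at e1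
    exact add_left_cancel e1
  obtain ⟨π, h1, h2, h3⟩ := exists_fun_of_types_eq c P P' U U' h.nodup hP hU
  have hall : ∀ x, x ∈ ends P + U := by
    intro x; rw [show ends P + U = _ from h]; exact Finset.mem_univ x
  have hs : Function.Surjective π := by
    intro y
    have : y ∈ (ends P + U).map π := by
      rw [Multiset.map_add, ← ends_map, h2, h3, show ends P' + U' = _ from h']
      exact Finset.mem_univ y
    obtain ⟨x, _, hx⟩ := Multiset.mem_map.1 this
    exact ⟨x, hx⟩
  refine ⟨Equiv.ofBijective π ⟨Finite.injective_iff_surjective.2 hs, hs⟩, ?_, ?_⟩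
  · intro x; exact h1 x (hall x)
  · exact h2

lemma mt_cons {α : Type} [Fintype α] {P : Multiset (Sym2 α)} {U : Multiset α} {h k : α} :
    Mt (s(h, k) ::ₘ P) U ↔ Mt P (h ::ₘ k ::ₘ U) := by
  simp only [Mt, ends_cons, Multiset.cons_add, Multiset.add_cons]

lemma Mt.nodupU {α : Type} [Fintype α] {P : Multiset (Sym2 α)} {U : Multiset α} (h : Mt P U) :
    U.Nodup := Multiset.nodup_of_le (Multiset.le_add_left _ _) h.nodup

lemma Mt.add_pair {α : Type} [Fintype α] {P : Multiset (Sym2 α)} {U : Multiset α} (h : Mt P U)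
    {x y : α} (hx : x ∈ U) (hy : y ∈ U) (hxy : x ≠ y) :
    ∃ U', U = x ::ₘ y ::ₘ U' ∧ Mt (s(x, y) ::ₘ P) U' := by
  obtain ⟨U1, rfl⟩ := Multiset.exists_cons_of_mem hx
  have hy' : y ∈ U1 := (Multiset.mem_cons.1 hy).resolve_left hxy.symm
  obtain ⟨U2, rfl⟩ := Multiset.exists_cons_of_mem hy'
  exact ⟨U2, rfl, mt_cons.2 h⟩

/-- Abstract properties of the symmetrized functional. -/
structure Good {α : Type} [Fintype α] (c : α → Bool) (κ : ℝ)
    (Γ : Multiset (Sym2 α) → ℝ) : Prop where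
  inv : ∀ π : Equiv.Perm α, (∀ x, c (π x) = c x) → ∀ P, Γ (P.map (Sym2.map π)) = Γ P
  lip : ∀ P h k, |Γ (s(h, k) ::ₘ P) - Γ P| ≤ κ
  conc : ∀ P (w : α → ℝ), ∑ x, w x = 0 →
    ∑ x, ∑ y, (Γ (s(x, y) ::ₘ P) - Γ P) * w x * w y ≤ 0

lemma Good.types {α : Type} [Fintype α] {c : α → Bool} {κ : ℝ} {Γ : Multiset (Sym2 α) → ℝ}
    (hG : Good c κ Γ) {P P' : Multiset (Sym2 α)} {U U' : Multiset α} (h : Mt P U) (h' : Mt P' U')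
    (hP : P.map (Sym2.map c) = P'.map (Sym2.map c)) : Γ P = Γ P' := by
  obtain ⟨π, h1, rfl⟩ := h.exists_perm c h' hP
  exact (hG.inv π h1 P).symm

lemma Good.pair_eq {α : Type} [Fintype α] {c : α → Bool} {κ : ℝ} {Γ : Multiset (Sym2 α) → ℝ}
    (hG : Good c κ Γ) {P : Multiset (Sym2 α)} {U : Multiset α} (h : Mt P U)
    {x y x' y' : α} (hx : x ∈ U) (hy : y ∈ U) (hxy : x ≠ y)
    (hx' : x' ∈ U) (hy' : y' ∈ U) (hxy' : x' ≠ y') (hc1 : c x = c x') (hc2 : c y = c y') :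
    Γ (s(x, y) ::ₘ P) = Γ (s(x', y') ::ₘ P) := by
  obtain ⟨U1, _, h1⟩ := h.add_pair hx hy hxy
  obtain ⟨U2, _, h2⟩ := h.add_pair hx' hy' hxy'
  exact hG.types h1 h2 (by simp [hc1, hc2])

lemma Good.kappa {α : Type} [Fintype α] {c : α → Bool} {κ : ℝ} {Γ : Multiset (Sym2 α) → ℝ}
    (hG : Good c κ Γ) (x : α) : 0 ≤ κ := (abs_nonneg _).trans (hG.lip 0 x x)

lemma sum_ge_aux {α : Type} (S : Finset α) (D : α → α → ℝ) (d κ : ℝ)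
    (h1 : ∀ x ∈ S, ∀ y ∈ S, x ≠ y → D x y = d) (h2 : ∀ x ∈ S, d - 2 * κ ≤ D x x) :
    (S.card : ℝ) * S.card * d - 2 * κ * S.card ≤ ∑ x ∈ S, ∑ y ∈ S, D x y := by
  have : ∀ x ∈ S, (S.card : ℝ) * d - 2 * κ ≤ ∑ y ∈ S, D x y := by
    intro x hx
    have e : (S.card : ℝ) * d - 2 * κ = ∑ y ∈ S, (d - if y = x then 2 * κ else 0) := by
      rw [Finset.sum_sub_distrib, Finset.sum_ite_eq' S x, if_pos hx]
      simp
    rw [e]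
    apply Finset.sum_le_sum
    intro y hy
    by_cases hyx : y = x
    · subst hyx; simpa using h2 y hx
    · rw [if_neg hyx, h1 x hx y hy (Ne.symm hyx)]; simp
  calc (S.card : ℝ) * S.card * d - 2 * κ * S.card = ∑ x ∈ S, ((S.card : ℝ) * d - 2 * κ) := by
        simp; ring
    _ ≤ _ := Finset.sum_le_sum this

lemma countP_eq_card {α : Type} [Fintype α] (c : α → Bool) (b : Bool) (U : Multiset α)
    (hU : U.Nodup) : U.countP (fun x => c x = b) =
      (Finset.univ.filter fun x => x ∈ U ∧ c x = b).card := by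
  rw [Multiset.countP_eq_card_filter, ← Multiset.toFinset_card_of_nodup (hU.filter _)]
  congr 1
  ext x
  simp

lemma sum_indicator {α : Type} [Fintype α] (S S' : Finset α) (D : α → α → ℝ) :
    ∑ x, ∑ y, D x y * (if x ∈ S then 1 else 0) * (if y ∈ S' then 1 else 0) =
      ∑ x ∈ S, ∑ y ∈ S', D x y := by
  have : ∀ x, ∑ y, D x y * (if x ∈ S then 1 else 0) * (if y ∈ S' then 1 else 0) =
      if x ∈ S then ∑ y ∈ S', D x y else 0 := by
    intro x
    by_cases hx : x ∈ S <;> simp [hx]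
  simp

lemma Good.step_conc {α : Type} [Fintype α] {c : α → Bool} {κ : ℝ} {Γ : Multiset (Sym2 α) → ℝ}
    (hG : Good c κ Γ) {P : Multiset (Sym2 α)} {U : Multiset α} (h : Mt P U)
    {x1 x2 y1 y2 : α} (hx1 : x1 ∈ U) (hx2 : x2 ∈ U) (hy1 : y1 ∈ U) (hy2 : y2 ∈ U)
    (hx : x1 ≠ x2) (hy : y1 ≠ y2) (cx1 : c x1 = true) (cx2 : c x2 = true)
    (cy1 : c y1 = false) (cy2 : c y2 = false) :
    Γ (s(x1, x2) ::ₘ P) + Γ (s(y1, y2) ::ₘ P) ≤ 2 * Γ (s(x1, y1) ::ₘ P) +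
      2 * κ / (U.countP (fun x => c x = true) : ℝ) +
      2 * κ / (U.countP (fun x => c x = false) : ℝ) := by
  rw [countP_eq_card c true U h.nodupU, countP_eq_card c false U h.nodupU]
  set S := Finset.univ.filter fun x => x ∈ U ∧ c x = true with hS
  set S' := Finset.univ.filter fun x => x ∈ U ∧ c x = false with hS'
  have mS : ∀ x, x ∈ S ↔ x ∈ U ∧ c x = true := by simp [hS]
  have mS' : ∀ x, x ∈ S' ↔ x ∈ U ∧ c x = false := by simp [hS']
  have pS : (0 : ℝ) < S.card := by
    exact_mod_cast Finset.card_pos.2 ⟨x1, (mS x1).2 ⟨hx1, cx1⟩⟩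
  have pS' : (0 : ℝ) < S'.card := by
    exact_mod_cast Finset.card_pos.2 ⟨y1, (mS' y1).2 ⟨hy1, cy1⟩⟩
  set D : α → α → ℝ := fun x y => Γ (s(x, y) ::ₘ P) - Γ P with hD
  have hDk : ∀ x y x' y', D x y - 2 * κ ≤ D x' y' := by
    intro x y x' y'
    have e1 := abs_le.1 (hG.lip P x y)
    have e2 := abs_le.1 (hG.lip P x' y')
    simp only [hD]; linarith [e1.1, e1.2, e2.1, e2.2]
  have hne : ∀ x ∈ S, ∀ y ∈ S', x ≠ y := by
    rintro x hx y hy rfl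
    have e1 := ((mS x).1 hx).2
    have e2 := ((mS' x).1 hy).2
    rw [e1] at e2; exact absurd e2 (by simp)
  have b1 := sum_ge_aux S D (D x1 x2) κ (by
    intro x hx' y hy' hxy
    rw [mS] at hx' hy'
    simp only [hD]
    rw [hG.pair_eq h hx'.1 hy'.1 hxy hx1 hx2 hx (hx'.2.trans cx1.symm) (hy'.2.trans cx2.symm)])
    (fun x _ => hDk _ _ _ _)
  have b2 := sum_ge_aux S' D (D y1 y2) κ (by
    intro x hx' y hy' hxy
    rw [mS'] at hx' hy'
    simp only [hD]
    rw [hG.pair_eq h hx'.1 hy'.1 hxy hy1 hy2 hy (hx'.2.trans cy1.symm) (hy'.2.trans cy2.symm)])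
    (fun x _ => hDk _ _ _ _)
  have hx1y1 : x1 ≠ y1 := hne _ ((mS _).2 ⟨hx1, cx1⟩) _ ((mS' _).2 ⟨hy1, cy1⟩)
  have b3 : ∑ x ∈ S, ∑ y ∈ S', D x y = S.card * S'.card * D x1 y1 := by
    rw [Finset.sum_congr rfl (fun x hx => Finset.sum_congr rfl (fun y hy =>
      show D x y = D x1 y1 from ?_))]
    · simp; ring
    · have hxy := hne x hx y hy
      rw [mS] at hx; rw [mS'] at hy
      simp only [hD]
      rw [hG.pair_eq h hx.1 hy.1 hxy hx1 hy1 hx1y1 (hx.2.trans cx1.symm) (hy.2.trans cy1.symm)]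
  have b4 : ∑ x ∈ S', ∑ y ∈ S, D x y = S.card * S'.card * D x1 y1 := by
    rw [← b3, Finset.sum_comm]
    apply Finset.sum_congr rfl; intro x _; apply Finset.sum_congr rfl; intro y _
    simp only [hD, Sym2.eq_swap]
  set p : ℝ := (S.card : ℝ) with hp
  set q : ℝ := (S'.card : ℝ) with hq
  have hc := hG.conc P (fun x => p⁻¹ * (if x ∈ S then 1 else 0) - q⁻¹ * (if x ∈ S' then 1 else 0))
    (by
      rw [Finset.sum_sub_distrib, ← Finset.mul_sum, ← Finset.mul_sum]
      simp only [Finset.sum_ite_mem, Finset.univ_inter, Finset.sum_const, nsmul_eq_mul, mul_one]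
      rw [← hp, ← hq, inv_mul_cancel₀ pS.ne', inv_mul_cancel₀ pS'.ne', sub_self])
  have key : ∑ x, ∑ y, (Γ (s(x, y) ::ₘ P) - Γ P) *
      (p⁻¹ * (if x ∈ S then 1 else 0) - q⁻¹ * (if x ∈ S' then 1 else 0)) *
      (p⁻¹ * (if y ∈ S then 1 else 0) - q⁻¹ * (if y ∈ S' then 1 else 0)) =
      p⁻¹ * p⁻¹ * (∑ x ∈ S, ∑ y ∈ S, D x y) - p⁻¹ * q⁻¹ * (∑ x ∈ S, ∑ y ∈ S', D x y)
      - p⁻¹ * q⁻¹ * (∑ x ∈ S', ∑ y ∈ S, D x y) + q⁻¹ * q⁻¹ * (∑ x ∈ S', ∑ y ∈ S', D x y) := by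
    rw [← sum_indicator S S, ← sum_indicator S S', ← sum_indicator S' S, ← sum_indicator S' S']
    simp only [Finset.mul_sum, ← Finset.sum_add_distrib, ← Finset.sum_sub_distrib]
    apply Finset.sum_congr rfl; intro x _; apply Finset.sum_congr rfl; intro y _
    simp only [hD]; ring
  rw [key, b3, b4] at hc
  have c1 : D x1 x2 - 2 * κ / p ≤ p⁻¹ * p⁻¹ * (∑ x ∈ S, ∑ y ∈ S, D x y) := by
    calc D x1 x2 - 2 * κ / p = p⁻¹ * p⁻¹ * (p * p * D x1 x2 - 2 * κ * p) := by
          field_simp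
      _ ≤ _ := by gcongr
  have c2 : D y1 y2 - 2 * κ / q ≤ q⁻¹ * q⁻¹ * (∑ x ∈ S', ∑ y ∈ S', D x y) := by
    calc D y1 y2 - 2 * κ / q = q⁻¹ * q⁻¹ * (q * q * D y1 y2 - 2 * κ * q) := by
          field_simp
      _ ≤ _ := by gcongr
  have c3 : p⁻¹ * q⁻¹ * (p * q * D x1 y1) = D x1 y1 := by
    field_simp
  rw [c3] at hc
  simp only [hD] at c1 c2 hc ⊢
  linarith

/-- Number of bichromatic pairs. -/
noncomputable def mixed {α : Type} (c : α → Bool) (P : Multiset (Sym2 α)) : ℕ :=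
  (P.map (Sym2.map c)).count s(true, false)

/-- Number of elements of colour `b`. -/
noncomputable def cnt {α : Type} (c : α → Bool) (b : Bool) (U : Multiset α) : ℕ :=
  U.countP (fun x => c x = b)

lemma cnt_cons {α : Type} (c : α → Bool) (b : Bool) (U : Multiset α) (x : α) :
    cnt c b (x ::ₘ U) = cnt c b U + if c x = b then 1 else 0 := by
  simp [cnt, Multiset.countP_cons]

lemma cnt_card {α : Type} (c : α → Bool) (U : Multiset α) :
    cnt c true U + cnt c false U = U.card := by
  induction U using Multiset.induction_on with
  | empty => simp [cnt]
  | cons x U ih =>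
    rw [cnt_cons, cnt_cons, Multiset.card_cons, ← ih]
    cases c x <;> simp <;> omega

lemma cnt_pos {α : Type} {c : α → Bool} {b : Bool} {U : Multiset α} (h : 1 ≤ cnt c b U) :
    ∃ x ∈ U, c x = b := Multiset.countP_pos.1 h

lemma cnt_two {α : Type} {c : α → Bool} {b : Bool} {U : Multiset α} (hU : U.Nodup)
    (h : 2 ≤ cnt c b U) : ∃ x ∈ U, ∃ y ∈ U, x ≠ y ∧ c x = b ∧ c y = b := by
  obtain ⟨x, hx, hcx⟩ := cnt_pos (by omega : 1 ≤ cnt c b U)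
  obtain ⟨U', rfl⟩ := Multiset.exists_cons_of_mem hx
  rw [cnt_cons, if_pos hcx] at h
  obtain ⟨y, hy, hcy⟩ := cnt_pos (by omega : 1 ≤ cnt c b U')
  refine ⟨x, hx, y, Multiset.mem_cons_of_mem hy, ?_, hcx, hcy⟩
  rintro rfl
  exact (Multiset.nodup_cons.1 hU).1 hy

lemma mixed_cons {α : Type} (c : α → Bool) (h k : α) (P : Multiset (Sym2 α)) :
    mixed c (s(h, k) ::ₘ P) = mixed c P + if c h = c k then 0 else 1 := by
  simp only [mixed, Multiset.map_cons, Sym2.map_mk, Multiset.count_cons]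
  cases c h <;> cases c k <;> simp

lemma exists_of_mixed {α : Type} {c : α → Bool} {P : Multiset (Sym2 α)} (h : 1 ≤ mixed c P) :
    ∃ x y P', P = s(x, y) ::ₘ P' ∧ c x = true ∧ c y = false := by
  have : s(true, false) ∈ P.map (Sym2.map c) := Multiset.count_pos.1 h
  obtain ⟨e, he, hce⟩ := Multiset.mem_map.1 this
  obtain ⟨P', rfl⟩ := Multiset.exists_cons_of_mem he
  induction e using Sym2.ind with
  | _ x y =>
    simp only [Sym2.map_mk, Sym2.eq_iff] at hce
    rcases hce with ⟨h1, h2⟩ | ⟨h1, h2⟩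
    · exact ⟨x, y, P', rfl, h1, h2⟩
    · exact ⟨y, x, P', by rw [Sym2.eq_swap], h2, h1⟩

lemma Good.step {α : Type} [Fintype α] {c : α → Bool} {κ : ℝ} {Γ : Multiset (Sym2 α) → ℝ}
    (hG : Good c κ Γ) {P : Multiset (Sym2 α)} {U : Multiset α} (h : Mt P U) (n p q : ℕ)
    (hn : mixed c P = n + 1) (hp : cnt c true U = p + 1) (hq : cnt c false U = q + 1) :
    ∃ P1 U1 P2 U2, Mt P1 U1 ∧ Mt P2 U2 ∧ mixed c P1 = n ∧ mixed c P2 = n ∧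
      cnt c true U1 = p ∧ cnt c false U1 = q + 2 ∧ cnt c true U2 = p + 2 ∧ cnt c false U2 = q ∧
      Γ P1 + Γ P2 ≤ 2 * Γ P + 2 * κ / (p + 2) + 2 * κ / (q + 2) ∧
      Γ P1 ≤ Γ P + 2 * κ ∧ Γ P2 ≤ Γ P + 2 * κ := by
  obtain ⟨x, y, P, rfl, cx, cy⟩ := exists_of_mixed (by omega : 1 ≤ mixed c P)
  have h0 := mt_cons.1 h
  obtain ⟨x', hx', cx'⟩ := cnt_pos (by omega : 1 ≤ cnt c true U)
  obtain ⟨y', hy', cy'⟩ := cnt_pos (by omega : 1 ≤ cnt c false U)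
  have nd := h0.nodupU
  obtain ⟨nd1, nd2⟩ := Multiset.nodup_cons.1 nd
  obtain ⟨nd3, nd4⟩ := Multiset.nodup_cons.1 nd2
  have hxx' : x ≠ x' := by rintro rfl; exact nd1 (Multiset.mem_cons_of_mem hx')
  have hyy' : y ≠ y' := by rintro rfl; exact nd3 hy'
  have mx : x ∈ x ::ₘ y ::ₘ U := by simp
  have my : y ∈ x ::ₘ y ::ₘ U := by simp
  have mx' : x' ∈ x ::ₘ y ::ₘ U := by simp [hx']
  have my' : y' ∈ x ::ₘ y ::ₘ U := by simp [hy']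
  obtain ⟨U1, hU1, m1⟩ := h0.add_pair mx mx' hxx'
  obtain ⟨U2, hU2, m2⟩ := h0.add_pair my my' hyy'
  have conc := hG.step_conc h0 mx mx' my my' hxx' hyy' cx cx' cy cy'
  have k1 := congrArg (cnt c true) hU1
  have k2 := congrArg (cnt c false) hU1
  have k3 := congrArg (cnt c true) hU2
  have k4 := congrArg (cnt c false) hU2
  have l1 : cnt c true (x ::ₘ y ::ₘ U) = p + 2 := by simp [cnt_cons, cx, cy, hp]
  have l2 : cnt c false (x ::ₘ y ::ₘ U) = q + 2 := by simp [cnt_cons, cx, cy, hq]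
  rw [l1] at k1 k3
  rw [l2] at k2 k4
  simp only [cnt_cons, cx, cx', cy, cy'] at k1 k2 k3 k4
  simp at k1 k2 k3 k4
  change _ ≤ _ + 2 * κ / ((cnt c true (x ::ₘ y ::ₘ U) : ℕ) : ℝ) +
    2 * κ / ((cnt c false (x ::ₘ y ::ₘ U) : ℕ) : ℝ) at conc
  rw [l1, l2] at conc
  push_cast at conc
  have hmix : mixed c P = n := by
    rw [mixed_cons] at hn; simp [cx, cy] at hn; exact hn
  have a1 := abs_le.1 (hG.lip P x y)
  have a2 := abs_le.1 (hG.lip P x x')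
  have a3 := abs_le.1 (hG.lip P y y')
  refine ⟨_, U1, _, U2, m1, m2, ?_, ?_, by omega, by omega, by omega, by omega, conc, ?_, ?_⟩
  · rw [mixed_cons]; simp [cx, cx', hmix]
  · rw [mixed_cons]; simp [cy, cy', hmix]
  · linarith [a1.1, a2.2]
  · linarith [a1.1, a3.2]

lemma Good.process {α : Type} [Fintype α] {c : α → Bool} {κ : ℝ} {Γ : Multiset (Sym2 α) → ℝ}
    (hG : Good c κ Γ) (hκ : 0 ≤ κ) (r T : ℕ) (hr : 1 ≤ r) (hT : 4 * r ≤ T) (n : ℕ) :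
    ∀ (P : Multiset (Sym2 α)) (U : Multiset α), Mt P U → mixed c P = n →
      r ≤ cnt c true U → r ≤ cnt c false U → U.card = T →
      ∃ P' U', Mt P' U' ∧ mixed c P' = 0 ∧ U'.card = T ∧
        Γ P' ≤ Γ P + 2 * κ / r * ((cnt c true U : ℝ) - T / 2) ^ 2 + n * (4 * κ / r) := by
  have hr0 : (0 : ℝ) < r := by exact_mod_cast hr
  induction n with
  | zero =>
    intro P U h hm _ _ hU
    refine ⟨P, U, h, hm, hU, ?_⟩
    have : 0 ≤ 2 * κ / r * ((cnt c true U : ℝ) - T / 2) ^ 2 := by positivity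
    simp; linarith
  | succ n ih =>
    intro P U h hm hp hq hU
    have hcard := cnt_card c U
    obtain ⟨p, hp'⟩ : ∃ p, cnt c true U = p + 1 := ⟨cnt c true U - 1, by omega⟩
    obtain ⟨q, hq'⟩ : ∃ q, cnt c false U = q + 1 := ⟨cnt c false U - 1, by omega⟩
    obtain ⟨P1, U1, P2, U2, m1, m2, x1, x2, t1, f1, t2, f2, hc, d1, d2⟩ :=
      hG.step h n p q hm hp' hq'
    have hc1 := cnt_card c U1
    have hc2 := cnt_card c U2
    have hTpq : (T : ℝ) = p + q + 2 := by
      have : T = p + q + 2 := by omega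
      rw [this]; push_cast; ring
    set l : ℝ := κ / r with hl
    have hl0 : 0 ≤ l := by positivity
    have hlr : l * r = κ := by rw [hl]; field_simp
    have e2 : 2 * κ / r = 2 * l := by rw [hl]; ring
    have e4 : 4 * κ / r = 4 * l := by rw [hl]; ring
    rw [hp', e2, e4]
    rw [e2, e4] at ih
    have T4 : 4 * (r : ℝ) ≤ p + q + 2 := by rw [← hTpq]; exact_mod_cast hT
    have r1 : (1 : ℝ) ≤ r := by exact_mod_cast hr
    have go1 : r ≤ p → Γ P1 + 2 * l * ((p : ℝ) - T / 2) ^ 2 ≤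
        Γ P + 2 * l * ((p : ℝ) + 1 - T / 2) ^ 2 + 4 * l →
        ∃ P' U', Mt P' U' ∧ mixed c P' = 0 ∧ U'.card = T ∧
        Γ P' ≤ Γ P + 2 * l * (((p + 1 : ℕ) : ℝ) - T / 2) ^ 2 + (n + 1 : ℕ) * (4 * l) := by
      intro h1 h2
      obtain ⟨P', U', a1, a2, a3, a4⟩ := ih P1 U1 m1 x1 (by omega) (by omega) (by omega)
      refine ⟨P', U', a1, a2, a3, a4.trans ?_⟩
      rw [t1]; push_cast; linarith
    have go2 : r ≤ q → Γ P2 + 2 * l * ((p : ℝ) + 2 - T / 2) ^ 2 ≤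
        Γ P + 2 * l * ((p : ℝ) + 1 - T / 2) ^ 2 + 4 * l →
        ∃ P' U', Mt P' U' ∧ mixed c P' = 0 ∧ U'.card = T ∧
        Γ P' ≤ Γ P + 2 * l * (((p + 1 : ℕ) : ℝ) - T / 2) ^ 2 + (n + 1 : ℕ) * (4 * l) := by
      intro h1 h2
      obtain ⟨P', U', a1, a2, a3, a4⟩ := ih P2 U2 m2 x2 (by omega) (by omega) (by omega)
      refine ⟨P', U', a1, a2, a3, a4.trans ?_⟩
      rw [t2]; push_cast; linarith
    by_cases hpr : p + 1 = r
    · apply go2 (by omega)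
      have hpr' : (r : ℝ) = p + 1 := by rw [← hpr]; push_cast; ring
      have : 2 * κ ≤ 2 * l * (T - 2 * r - 1) := by
        rw [← hlr]
        nlinarith
      rw [hpr'] at this
      nlinarith
    by_cases hqr : q + 1 = r
    · apply go1 (by omega)
      have hqr' : (r : ℝ) = q + 1 := by rw [← hqr]; push_cast; ring
      have : 2 * κ ≤ 2 * l * (T - 2 * r - 1) := by
        rw [← hlr]
        nlinarith
      rw [hqr'] at this
      rw [hTpq] at this ⊢
      nlinarith
    have bp : (r : ℝ) ≤ p := by exact_mod_cast (by omega : r ≤ p)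
    have bq : (r : ℝ) ≤ q := by exact_mod_cast (by omega : r ≤ q)
    have g1 : 2 * κ / (p + 2) ≤ 2 * l := by
      rw [← e2]; gcongr; linarith
    have g2 : 2 * κ / (q + 2) ≤ 2 * l := by
      rw [← e2]; gcongr; linarith
    by_cases hh : Γ P1 + 2 * l * ((p : ℝ) - T / 2) ^ 2 ≤
        Γ P + 2 * l * ((p : ℝ) + 1 - T / 2) ^ 2 + 4 * l
    · exact go1 (by omega) hh
    · apply go2 (by omega)
      push Not at hh
      nlinarith

/-- Remove `L` bichromatic pairs. -/
lemma Good.remove {α : Type} [Fintype α] {c : α → Bool} {κ : ℝ} {Γ : Multiset (Sym2 α) → ℝ}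
    (hG : Good c κ Γ) (L : ℕ) :
    ∀ (P : Multiset (Sym2 α)) (U : Multiset α), Mt P U → L ≤ mixed c P →
      ∃ P' U', Mt P' U' ∧ mixed c P' + L = mixed c P ∧ cnt c true U' = cnt c true U + L ∧
        cnt c false U' = cnt c false U + L ∧ Γ P' ≤ Γ P + L * κ := by
  induction L with
  | zero => intro P U h _; exact ⟨P, U, h, by simp⟩
  | succ L ih =>
    intro P U h hL
    obtain ⟨x, y, P, rfl, cx, cy⟩ := exists_of_mixed (by omega : 1 ≤ mixed c P)
    have hm : mixed c (s(x, y) ::ₘ P) = mixed c P + 1 := by rw [mixed_cons]; simp [cx, cy]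
    obtain ⟨P', U', a1, a2, a3, a4, a5⟩ := ih P _ (mt_cons.1 h) (by omega)
    simp [cnt_cons, cx, cy] at a3 a4
    have := abs_le.1 (hG.lip P x y)
    refine ⟨P', U', a1, by omega, by omega, by omega, ?_⟩
    push_cast
    linarith [this.1]

/-- Extend a monochromatic matching until at most one element of each colour is free. -/
lemma Good.extend {α : Type} [Fintype α] {c : α → Bool} {κ : ℝ} {Γ : Multiset (Sym2 α) → ℝ}
    (hG : Good c κ Γ) (hκ : 0 ≤ κ) (n : ℕ) :
    ∀ (P : Multiset (Sym2 α)) (U : Multiset α), Mt P U → mixed c P = 0 → U.card ≤ 2 * n + 1 →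
      ∃ P' U', Mt P' U' ∧ mixed c P' = 0 ∧ cnt c true U' ≤ 1 ∧
        cnt c false U' ≤ 1 ∧ Γ P' ≤ Γ P + n * κ := by
  induction n with
  | zero =>
    intro P U h hm hU
    have := cnt_card c U
    exact ⟨P, U, h, hm, by omega, by omega, by simp⟩
  | succ n ih =>
    intro P U h hm hU
    by_cases hh : ∃ b, 2 ≤ cnt c b U
    · obtain ⟨b, hb⟩ := hh
      obtain ⟨x, hx, y, hy, hxy, cx, cy⟩ := cnt_two h.nodupU hb
      obtain ⟨U', rfl, hM⟩ := h.add_pair hx hy hxy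
      obtain ⟨P', U'', a1, a2, a3, a4, a5⟩ := ih _ _ hM (by rw [mixed_cons]; simp [cx, cy, hm])
        (by simp at hU; omega)
      have := abs_le.1 (hG.lip P x y)
      refine ⟨P', U'', a1, a2, a3, a4, ?_⟩
      push_cast
      linarith [this.2]
    · push Not at hh
      refine ⟨P, U, h, hm, by have := hh true; omega, by have := hh false; omega, ?_⟩
      have : 0 ≤ ((n + 1 : ℕ) : ℝ) * κ := by positivity
      linarith

lemma types_of_pure {α : Type} (c : α → Bool) (P : Multiset (Sym2 α)) (hm : mixed c P = 0) :
    ∃ i j, P.map (Sym2.map c) = Multiset.replicate i s(true, true) +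
      Multiset.replicate j s(false, false) ∧ cnt c true (ends P) = 2 * i ∧
      cnt c false (ends P) = 2 * j := by
  induction P using Multiset.induction_on with
  | empty => exact ⟨0, 0, by simp [ends, cnt]⟩
  | cons e P ih =>
    induction e using Sym2.ind with
    | _ x y =>
      rw [mixed_cons] at hm
      obtain ⟨i, j, h1, h2, h3⟩ := ih (by omega)
      have hc : c x = c y := by by_contra hc; simp [hc] at hm
      rw [ends_cons]
      cases hx : c x
      · rw [hx] at hc
        refine ⟨i, j + 1, ?_, ?_, ?_⟩
        · simp [h1, hx, ← hc, Multiset.replicate_succ]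
        · simp [cnt_cons, hx, ← hc, h2]
        · simp [cnt_cons, hx, ← hc, h3]; ring
      · rw [hx] at hc
        refine ⟨i + 1, j, ?_, ?_, ?_⟩
        · simp [h1, hx, ← hc, Multiset.replicate_succ]
        · simp [cnt_cons, hx, ← hc, h2]; ring
        · simp [cnt_cons, hx, ← hc, h3]

lemma Good.pure_eq {α : Type} [Fintype α] {c : α → Bool} {κ : ℝ} {Γ : Multiset (Sym2 α) → ℝ}
    (hG : Good c κ Γ) {P P' : Multiset (Sym2 α)} {U U' : Multiset α} (h : Mt P U) (h' : Mt P' U')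
    (m : mixed c P = 0) (m' : mixed c P' = 0) (u1 : cnt c true U ≤ 1) (u2 : cnt c false U ≤ 1)
    (v1 : cnt c true U' ≤ 1) (v2 : cnt c false U' ≤ 1) : Γ P = Γ P' := by
  apply hG.types h h'
  obtain ⟨i, j, h1, h2, h3⟩ := types_of_pure c P m
  obtain ⟨i', j', h1', h2', h3'⟩ := types_of_pure c P' m'
  have e := h.trans h'.symm
  have e1 := congrArg (cnt c true) e
  have e2 := congrArg (cnt c false) e
  have ca : ∀ b (X Y : Multiset α), cnt c b (X + Y) = cnt c b X + cnt c b Y := by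
    intro b X Y; simp [cnt]
  rw [ca, ca, h2, h2'] at e1
  rw [ca, ca, h3, h3'] at e2
  rw [h1, h1', show i = i' by omega, show j = j' by omega]

lemma mixed_le {α : Type} [Fintype α] {c : α → Bool} {P : Multiset (Sym2 α)} {U : Multiset α}
    (h : Mt P U) : (mixed c P : ℝ) ≤ (Fintype.card α : ℝ) / 2 := by
  have h1 : mixed c P ≤ P.card := by
    have := Multiset.count_le_card s(true, false) (P.map (Sym2.map c))
    simpa [mixed] using this
  have h2 := h.card
  have : ((2 * mixed c P : ℕ) : ℝ) ≤ (Fintype.card α : ℕ) := by exact_mod_cast (by omega)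
  push_cast at this
  linarith

/-- Crude bound. -/
lemma Good.crude {α : Type} [Fintype α] {c : α → Bool} {κ : ℝ} {Γ : Multiset (Sym2 α) → ℝ}
    (hG : Good c κ Γ) (hκ : 0 ≤ κ) {P P' : Multiset (Sym2 α)} {U U' : Multiset α}
    (h : Mt P U) (h' : Mt P' U') (hU : U.card ≤ 1)
    (m' : mixed c P' = 0) (v1 : cnt c true U' ≤ 1) (v2 : cnt c false U' ≤ 1) :
    Γ P' ≤ Γ P + 2 * κ * mixed c P := by
  obtain ⟨P1, U1, a1, a2, a3, a4, a5⟩ := hG.remove (mixed c P) P U h le_rfl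
  have k := cnt_card c U
  have k1 := cnt_card c U1
  obtain ⟨P2, U2, b1, b2, b3, b4, b5⟩ := hG.extend hκ (mixed c P) P1 U1 a1 (by omega) (by omega)
  rw [hG.pure_eq h' b1 m' b2 v1 v2 b3 b4]
  linarith

/-- Main bound. -/
lemma Good.main {α : Type} [Fintype α] {c : α → Bool} {κ : ℝ} {Γ : Multiset (Sym2 α) → ℝ}
    (hG : Good c κ Γ) (hκ : 0 ≤ κ) {P P' : Multiset (Sym2 α)} {U U' : Multiset α}
    (h : Mt P U) (h' : Mt P' U') (hU : U.card ≤ 1)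
    (m' : mixed c P' = 0) (v1 : cnt c true U' ≤ 1) (v2 : cnt c false U' ≤ 1)
    (r : ℕ) (hr : 1 ≤ r) :
    Γ P' ≤ Γ P + κ * (4 * r + 4 * ((Fintype.card α : ℝ) / 2) / r) := by
  have hx := mixed_le (c := c) h
  set x : ℝ := (Fintype.card α : ℝ) / 2 with hxd
  have hx0 : 0 ≤ x := by positivity
  have hr0 : (1 : ℝ) ≤ r := by exact_mod_cast hr
  by_cases hL : mixed c P < 2 * r
  · have h1 := hG.crude hκ h h' hU m' v1 v2
    have h2 : (mixed c P : ℝ) ≤ 2 * r := by exact_mod_cast hL.le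
    have h3 : 0 ≤ 4 * x / r := by positivity
    nlinarith
  · push Not at hL
    obtain ⟨P1, U1, a1, a2, a3, a4, a5⟩ := hG.remove (2 * r) P U h hL
    have k := cnt_card c U
    have k1 := cnt_card c U1
    obtain ⟨P2, U2, b1, b2, b3, b4⟩ := hG.process hκ r U1.card hr (by omega) (mixed c P1) P1 U1 a1 rfl
      (by omega) (by omega) rfl
    obtain ⟨P3, U3, d1, d2, d3, d4, d5⟩ := hG.extend hκ (2 * r) P2 U2 b1 b2 (by omega)
    rw [hG.pure_eq h' d1 m' d2 v1 v2 d3 d4]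
    have hsq : ((cnt c true U1 : ℝ) - U1.card / 2) ^ 2 ≤ 1 := by
      have e1 : (U1.card : ℝ) = cnt c true U1 + cnt c false U1 := by exact_mod_cast k1.symm
      have e2 : (cnt c true U1 : ℝ) ≤ cnt c false U1 + 1 := by exact_mod_cast (by omega)
      have e3 : (cnt c false U1 : ℝ) ≤ cnt c true U1 + 1 := by exact_mod_cast (by omega)
      rw [e1]
      nlinarith
    have hm : (mixed c P1 : ℝ) + 2 * r ≤ x := by
      have : ((mixed c P1 + 2 * r : ℕ) : ℝ) = mixed c P := by rw [a2]
      push_cast at this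
      linarith
    have f1 : 2 * κ / r * ((cnt c true U1 : ℝ) - U1.card / 2) ^ 2 ≤ 2 * κ / r * 1 := by
      gcongr
    have f2 : (mixed c P1 : ℝ) * (4 * κ / r) ≤ (x - 2 * r) * (4 * κ / r) := by
      gcongr; linarith
    have f3 : (x - 2 * r) * (4 * κ / r) = κ * (4 * x / r) - 8 * κ := by
      field_simp; ring
    have f4 : 2 * κ / r ≤ 2 * κ := by
      apply div_le_self <;> linarith
    push_cast at a5 d5
    linarith

/-- The action of an equivalence on unordered pairs. -/
def sEquiv {α β : Type} (e : α ≃ β) : Sym2 α ≃ Sym2 β where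
  toFun := Sym2.map e
  invFun := Sym2.map e.symm
  left_inv p := by rw [Sym2.map_map]; simp
  right_inv p := by rw [Sym2.map_map]; simp

/-- The set of maximal matchings of a finite type. -/
noncomputable def maxSet (α : Type) [Fintype α] : Finset (Finset (Sym2 α)) :=
  Finset.univ.filter fun m => IsMaximalMatching m

lemma mem_maxSet {α : Type} [Fintype α] (m : Finset (Sym2 α)) :
    m ∈ maxSet α ↔ IsMaximalMatching m := by simp [maxSet]

lemma pairMatching_map {α β : Type} (e : α ≃ β) (m : Finset (Sym2 α)) (h : IsPairMatching m) :
    IsPairMatching (m.map (sEquiv e).toEmbedding) := by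
  have hmem : ∀ (p : Sym2 α) (x : β), x ∈ Sym2.map e p → e.symm x ∈ p := by
    intro p x hx
    obtain ⟨a, ha, rfl⟩ := Sym2.mem_map.1 hx
    simpa using ha
  constructor
  · intro p hp
    obtain ⟨q, hq, rfl⟩ := Finset.mem_map.1 hp
    have := h.1 q hq
    change ¬ (Sym2.map e q).IsDiag
    rwa [Sym2.isDiag_map e.injective]
  · intro p hp q hq hpq x hx hx'
    obtain ⟨p, hp', rfl⟩ := Finset.mem_map.1 hp
    obtain ⟨q, hq', rfl⟩ := Finset.mem_map.1 hq
    refine h.2 p hp' q hq' ?_ (e.symm x) (hmem p x hx) (hmem q x hx')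
    rintro rfl; exact hpq rfl

lemma map_map_symm {α β : Type} (e : α ≃ β) (m : Finset (Sym2 β)) :
    (m.map (sEquiv e.symm).toEmbedding).map (sEquiv e).toEmbedding = m := by
  rw [Finset.map_map]
  convert Finset.map_refl
  apply Function.Embedding.ext
  intro p
  exact (sEquiv e).apply_symm_apply p

lemma maximal_map {α β : Type} (e : α ≃ β) (m : Finset (Sym2 α)) (h : IsMaximalMatching m) :
    IsMaximalMatching (m.map (sEquiv e).toEmbedding) := by
  refine ⟨pairMatching_map e m h.1, ?_⟩
  intro m' hm' hs
  have h1 := h.2 (m'.map (sEquiv e.symm).toEmbedding) (pairMatching_map e.symm m' hm') (by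
    have := Finset.map_subset_map (f := (sEquiv e.symm).toEmbedding).2 hs
    have e2 := map_map_symm e.symm m
    rw [Equiv.symm_symm] at e2
    rwa [e2] at this)
  rw [← h1, map_map_symm]

lemma sum_maxSet {α β : Type} [Fintype α] [Fintype β] (e : α ≃ β)
    (g : Multiset (Sym2 β) → ℝ) :
    ∑ m ∈ maxSet β, g m.val = ∑ m ∈ maxSet α, g (m.val.map (Sym2.map e)) := by
  symm
  refine Finset.sum_bij' (fun m _ => m.map (sEquiv e).toEmbedding)
    (fun m _ => m.map (sEquiv e.symm).toEmbedding) ?_ ?_ ?_ ?_ ?_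
  · intro m hm; rw [mem_maxSet] at *; exact maximal_map e m hm
  · intro m hm; rw [mem_maxSet] at *; exact maximal_map e.symm m hm
  · intro m _
    have e2 := map_map_symm e.symm m
    rwa [Equiv.symm_symm] at e2
  · intro m _; exact map_map_symm e m
  · intro m _; rfl

lemma card_maxSet {α β : Type} [Fintype α] [Fintype β] (e : α ≃ β) :
    ((maxSet β).card : ℝ) = (maxSet α).card := by
  simpa using sum_maxSet e (fun _ => (1 : ℝ))

lemma maxSet_nonempty (α : Type) [Fintype α] : (maxSet α).Nonempty := by
  obtain ⟨m, hm, hmax⟩ := Finset.exists_max_image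
    (Finset.univ.filter fun m : Finset (Sym2 α) => IsPairMatching m) Finset.card
    ⟨∅, Finset.mem_filter.2 ⟨Finset.mem_univ _, by simp [IsPairMatching]⟩⟩
  refine ⟨m, (mem_maxSet m).2 ⟨by simpa using hm, ?_⟩⟩
  intro m' hm' hs
  exact (Finset.eq_of_subset_of_card_le hs (hmax m' (by simpa using hm'))).symm

lemma ends_mem {α : Type} {P : Multiset (Sym2 α)} {x : α} : x ∈ ends P ↔ ∃ p ∈ P, x ∈ p := by
  simp [ends, Multiset.mem_bind]

lemma ends_nodup {α : Type} (m : Finset (Sym2 α)) (h : IsPairMatching m) :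
    (ends m.val).Nodup := by
  induction m using Finset.induction_on with
  | empty => simp [ends]
  | insert e m he ih =>
    have hm : IsPairMatching m :=
      ⟨fun p hp => h.1 p (Finset.mem_insert_of_mem hp), fun p hp q hq =>
        h.2 p (Finset.mem_insert_of_mem hp) q (Finset.mem_insert_of_mem hq)⟩
    have ih := ih hm
    rw [Finset.insert_val_of_notMem he]
    have hd := h.1 e (Finset.mem_insert_self _ _)
    have hx : ∀ x, x ∈ e → x ∉ ends m.val := by
      intro x hx hx'
      obtain ⟨p, hp, hxp⟩ := ends_mem.1 hx'
      refine h.2 e (Finset.mem_insert_self _ _) p (Finset.mem_insert_of_mem hp) ?_ x hx hxp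
      rintro rfl; exact he hp
    induction e using Sym2.ind with
    | _ a b =>
      rw [ends_cons, Multiset.nodup_cons, Multiset.nodup_cons]
      refine ⟨?_, hx b (by simp), ih⟩
      rw [Multiset.mem_cons]
      rintro (rfl | h1)
      · exact hd (by simp)
      · exact hx a (by simp) h1

lemma exists_free {α : Type} [Fintype α] (m : Finset (Sym2 α)) (h : IsMaximalMatching m) :
    ∃ U, Mt m.val U ∧ U.card ≤ 1 := by
  have hn := ends_nodup m h.1
  have hle : ends m.val ≤ (Finset.univ : Finset α).val :=
    (Multiset.le_iff_subset hn).2 fun x _ => Finset.mem_univ x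
  obtain ⟨U, hU⟩ := Multiset.le_iff_exists_add.1 hle
  have hM : Mt m.val U := hU.symm
  refine ⟨U, hM, ?_⟩
  by_contra hc
  push Not at hc
  have h2 : 2 ≤ cnt (fun _ : α => true) true U := by
    simp only [cnt, Multiset.countP_True]; omega
  obtain ⟨x, hx, y, hy, hxy, -, -⟩ := cnt_two hM.nodupU h2
  have hd := (Multiset.nodup_add.1 hM.nodup).2.2
  have hx' : x ∉ ends m.val := fun h => Multiset.disjoint_left.1 hd h hx
  have hy' : y ∉ ends m.val := fun h => Multiset.disjoint_left.1 hd h hy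
  have hnot : s(x, y) ∉ m := fun h => hx' (ends_mem.2 ⟨_, h, by simp⟩)
  have key : ∀ q ∈ m, ∀ z, z ∈ s(x, y) → z ∉ q := by
    intro q hq z hz hzq
    rcases Sym2.mem_iff.1 hz with rfl | rfl
    · exact hx' (ends_mem.2 ⟨_, hq, hzq⟩)
    · exact hy' (ends_mem.2 ⟨_, hq, hzq⟩)
  have := h.2 (insert s(x, y) m) ⟨?_, ?_⟩ (Finset.subset_insert _ _)
  · exact hnot (this ▸ Finset.mem_insert_self _ _)
  · intro p hp
    rcases Finset.mem_insert.1 hp with rfl | hp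
    · simpa using hxy
    · exact h.1.1 p hp
  · intro p hp q hq hpq z hz hzq
    rcases Finset.mem_insert.1 hp with rfl | hp <;> rcases Finset.mem_insert.1 hq with rfl | hq
    · exact hpq rfl
    · exact key q hq z hz hzq
    · exact key p hp z hzq hz
    · exact h.1.2 p hp q hq hpq z hz hzq

/-- Symmetrized functional. -/
noncomputable def Gam {X Y V : Type} [Fintype X] [Fintype Y] (v : X ⊕ Y → V)
    (F : Multiset (Sym2 V) → ℝ) (P : Multiset (Sym2 (X ⊕ Y))) : ℝ :=
  (∑ σ : Equiv.Perm X × Equiv.Perm Y,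
    F (P.map (Sym2.map (v ∘ Equiv.sumCongr σ.1 σ.2)))) /
    (Fintype.card (Equiv.Perm X × Equiv.Perm Y) : ℝ)

lemma Gam_const {X Y : Type} [Fintype X] [Fintype Y]
    (a : ℝ) : (∑ _σ : Equiv.Perm X × Equiv.Perm Y, a) /
    (Fintype.card (Equiv.Perm X × Equiv.Perm Y) : ℝ) = a := by
  have : (Fintype.card (Equiv.Perm X × Equiv.Perm Y) : ℝ) ≠ 0 := by
    exact_mod_cast Fintype.card_ne_zero
  rw [Finset.sum_const, Finset.card_univ, nsmul_eq_mul]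
  field_simp

lemma good_Gam (f : Multigraph → ℝ) (κ : ℝ)
    (hlip : GraphParam.Lipschitz f κ) (hconc : GraphParam.Concave f)
    {X Y V : Type} [Fintype X] [Fintype Y] [Fintype V] (v : X ⊕ Y → V) :
    Good (α := X ⊕ Y) Sum.isLeft κ (Gam v fun E => f ⟨V, E⟩) := by
  have hN : (0 : ℝ) < (Fintype.card (Equiv.Perm X × Equiv.Perm Y) : ℝ) := by
    exact_mod_cast Fintype.card_pos
  refine ⟨?_, ?_, ?_⟩
  · intro π hπ P
    have hmem : π ∈ (Equiv.Perm.sumCongrHom X Y).range := by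
      apply Equiv.Perm.mem_sumCongrHom_range_of_perm_mapsTo_inl
      rintro _ ⟨a, rfl⟩
      have := hπ (Sum.inl a)
      rcases h : π (Sum.inl a) with b | b
      · exact ⟨b, rfl⟩
      · rw [h] at this; simp at this
    obtain ⟨⟨a, b⟩, rfl⟩ := hmem
    unfold Gam
    congr 1
    refine Fintype.sum_equiv (Equiv.mulRight (a, b)) _ _ ?_
    intro σ
    refine congrArg (fun E => f ⟨V, E⟩) ?_
    rw [Multiset.map_map]
    apply Multiset.map_congr rfl
    intro p _
    rw [Function.comp_apply, Sym2.map_map]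
    congr 1
    ext x
    rcases x with x | x <;> simp
  · intro P h k
    unfold Gam
    rw [← sub_div, ← Finset.sum_sub_distrib, abs_div, abs_of_pos hN, div_le_iff₀ hN]
    refine (Finset.abs_sum_le_sum_abs _ _).trans ?_
    calc _ ≤ ∑ σ : Equiv.Perm X × Equiv.Perm Y, κ := by
          apply Finset.sum_le_sum
          intro σ _
          rw [Multiset.map_cons]
          exact hlip ⟨V, _⟩ _ _
      _ = _ := by rw [Finset.sum_const, Finset.card_univ, nsmul_eq_mul, mul_comm]
  · intro P w hw
    have hσ : ∀ σ : Equiv.Perm X × Equiv.Perm Y, ∑ x, ∑ y,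
        (f ⟨V, (s(x, y) ::ₘ P).map (Sym2.map (v ∘ Equiv.sumCongr σ.1 σ.2))⟩ -
         f ⟨V, P.map (Sym2.map (v ∘ Equiv.sumCongr σ.1 σ.2))⟩) * w x * w y ≤ 0 := by
      intro σ
      set u := v ∘ Equiv.sumCongr σ.1 σ.2 with hu
      set G : Multigraph := ⟨V, P.map (Sym2.map u)⟩ with hGdef
      have h0 := hconc G (fun i : V => ∑ x, if u x = i then w x else 0) (by
        change ∑ i : V, _ = 0
        rw [Finset.sum_comm]
        simpa using hw)
      refine le_of_eq_of_le ?_ h0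
      set D : V → V → ℝ := fun i j => f (G.addEdge i j) - f G with hD
      change ∑ x, ∑ y, (f ⟨V, (s(x, y) ::ₘ P).map (Sym2.map u)⟩ - f G) * w x * w y =
        ∑ i : V, ∑ j : V, D i j * (∑ x, if u x = i then w x else 0) *
          (∑ y, if u y = j then w y else 0)
      have e1 : ∀ x y, f ⟨V, (s(x, y) ::ₘ P).map (Sym2.map u)⟩ - f G = D (u x) (u y) := by
        intro x y; rw [Multiset.map_cons]; rfl
      have e2 : ∀ i j, D i j * (∑ x, if u x = i then w x else 0) *
          (∑ y, if u y = j then w y else 0) =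
          ∑ x, ∑ y, if u x = i then (if u y = j then D i j * w x * w y else 0) else 0 := by
        intro i j
        rw [mul_assoc, Finset.sum_mul_sum, Finset.mul_sum]
        apply Finset.sum_congr rfl; intro x _
        rw [Finset.mul_sum]
        apply Finset.sum_congr rfl; intro y _
        split_ifs <;> simp [mul_assoc]
      simp only [e1, e2]
      symm
      calc _ = ∑ i : V, ∑ x, ∑ j : V, ∑ y,
            (if u x = i then (if u y = j then D i j * w x * w y else 0) else 0) := by
            apply Finset.sum_congr rfl; intro i _; exact Finset.sum_comm
        _ = ∑ x, ∑ i : V, ∑ j : V, ∑ y,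
            (if u x = i then (if u y = j then D i j * w x * w y else 0) else 0) :=
            Finset.sum_comm
        _ = ∑ x, ∑ i : V, ∑ y, ∑ j : V,
            (if u x = i then (if u y = j then D i j * w x * w y else 0) else 0) := by
            apply Finset.sum_congr rfl; intro x _; apply Finset.sum_congr rfl; intro i _
            exact Finset.sum_comm
        _ = ∑ x, ∑ y, ∑ i : V, ∑ j : V,
            (if u x = i then (if u y = j then D i j * w x * w y else 0) else 0) := by
            apply Finset.sum_congr rfl; intro x _; exact Finset.sum_comm
        _ = _ := by
            apply Finset.sum_congr rfl; intro x _; apply Finset.sum_congr rfl; intro y _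
            simp
    have : ∑ x, ∑ y, (Gam v (fun E => f ⟨V, E⟩) (s(x, y) ::ₘ P) -
        Gam v (fun E => f ⟨V, E⟩) P) * w x * w y =
        (∑ σ : Equiv.Perm X × Equiv.Perm Y, ∑ x, ∑ y,
        (f ⟨V, (s(x, y) ::ₘ P).map (Sym2.map (v ∘ Equiv.sumCongr σ.1 σ.2))⟩ -
         f ⟨V, P.map (Sym2.map (v ∘ Equiv.sumCongr σ.1 σ.2))⟩) * w x * w y) /
         (Fintype.card (Equiv.Perm X × Equiv.Perm Y) : ℝ) := by
      symm
      rw [Finset.sum_comm, Finset.sum_div]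
      apply Finset.sum_congr rfl; intro x _
      rw [Finset.sum_comm, Finset.sum_div]
      apply Finset.sum_congr rfl; intro y _
      symm
      unfold Gam
      rw [← sub_div, ← Finset.sum_sub_distrib, div_mul_eq_mul_div, div_mul_eq_mul_div,
        Finset.sum_mul, Finset.sum_mul]
    rw [this]
    exact div_nonpos_of_nonpos_of_nonneg (Finset.sum_nonpos fun σ _ => hσ σ) hN.le

lemma sum_Gam {X Y V : Type} [Fintype X] [Fintype Y] (v : X ⊕ Y → V)
    (F : Multiset (Sym2 V) → ℝ) :
    ∑ m ∈ maxSet (X ⊕ Y), Gam v F m.val = ∑ m ∈ maxSet (X ⊕ Y), F (m.val.map (Sym2.map v)) := by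
  unfold Gam
  rw [← Finset.sum_div, Finset.sum_comm]
  rw [← Gam_const (X := X) (Y := Y) (∑ m ∈ maxSet (X ⊕ Y), F (m.val.map (Sym2.map v)))]
  congr 1
  apply Finset.sum_congr rfl
  intro σ _
  rw [sum_maxSet (Equiv.sumCongr σ.1 σ.2) (fun P => F (P.map (Sym2.map v)))]
  simp only [Multiset.map_map, Function.comp_def, Sym2.map_map]

/-- Union of two matchings. -/
def pairU {X Y : Type} (P : Multiset (Sym2 X)) (Q : Multiset (Sym2 Y)) :
    Multiset (Sym2 (X ⊕ Y)) := P.map (Sym2.map Sum.inl) + Q.map (Sym2.map Sum.inr)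

lemma pairU_map {X Y : Type} (P : Multiset (Sym2 X)) (Q : Multiset (Sym2 Y))
    (a : Equiv.Perm X) (b : Equiv.Perm Y) :
    (pairU P Q).map (Sym2.map (Equiv.sumCongr a b)) =
      pairU (P.map (Sym2.map a)) (Q.map (Sym2.map b)) := by
  simp [pairU, Multiset.map_map, Function.comp_def, Sym2.map_map]

lemma sum_Gam_pair {X Y V : Type} [Fintype X] [Fintype Y] (v : X ⊕ Y → V)
    (F : Multiset (Sym2 V) → ℝ) :
    ∑ m ∈ maxSet X, ∑ m' ∈ maxSet Y, Gam v F (pairU m.val m'.val) =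
      ∑ m ∈ maxSet X, ∑ m' ∈ maxSet Y, F ((pairU m.val m'.val).map (Sym2.map v)) := by
  unfold Gam
  simp only [← Finset.sum_div]
  rw [← Gam_const (X := X) (Y := Y)
    (∑ m ∈ maxSet X, ∑ m' ∈ maxSet Y, F ((pairU m.val m'.val).map (Sym2.map v)))]
  congr 1
  rw [Finset.sum_congr rfl (fun m _ => Finset.sum_comm), Finset.sum_comm]
  apply Finset.sum_congr rfl
  intro σ _
  rw [sum_maxSet σ.1 (fun P => ∑ m' ∈ maxSet Y, F ((pairU P m'.val).map (Sym2.map v)))]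
  apply Finset.sum_congr rfl
  intro m _
  rw [sum_maxSet σ.2 (fun Q => F ((pairU (m.val.map (Sym2.map σ.1)) Q).map (Sym2.map v)))]
  apply Finset.sum_congr rfl
  intro m' _
  rw [← pairU_map, Multiset.map_map]
  congr 1
  apply Multiset.map_congr rfl
  intro p _
  rw [Function.comp_apply, Sym2.map_map]

lemma pairU_spec {X Y : Type} [Fintype X] [Fintype Y] (m : Finset (Sym2 X))
    (m' : Finset (Sym2 Y)) (hm : IsMaximalMatching m) (hm' : IsMaximalMatching m') :
    mixed (Sum.isLeft : X ⊕ Y → Bool) (pairU m.val m'.val) = 0 ∧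
    ∃ U, Mt (pairU m.val m'.val) U ∧ cnt (Sum.isLeft : X ⊕ Y → Bool) true U ≤ 1 ∧
      cnt (Sum.isLeft : X ⊕ Y → Bool) false U ≤ 1 := by
  constructor
  · unfold mixed
    rw [Multiset.count_eq_zero]
    intro h
    obtain ⟨p, hp, h⟩ := Multiset.mem_map.1 h
    rcases Multiset.mem_add.1 hp with hp | hp
    · obtain ⟨q, _, rfl⟩ := Multiset.mem_map.1 hp
      induction q using Sym2.ind with
      | _ a b => simp at h
    · obtain ⟨q, _, rfl⟩ := Multiset.mem_map.1 hp
      induction q using Sym2.ind with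
      | _ a b => simp at h
  · obtain ⟨U, h1, h2⟩ := exists_free m hm
    obtain ⟨U', h1', h2'⟩ := exists_free m' hm'
    refine ⟨U.map Sum.inl + U'.map Sum.inr, ?_, ?_, ?_⟩
    · unfold Mt pairU
      rw [ends_add, ends_map, ends_map]
      have : (Finset.univ : Finset (X ⊕ Y)).val =
          (Finset.univ : Finset X).val.map Sum.inl + (Finset.univ : Finset Y).val.map Sum.inr := rfl
      rw [this, ← show ends m.val + U = _ from h1, ← show ends m'.val + U' = _ from h1',
        Multiset.map_add, Multiset.map_add]
      abel
    · simpa [cnt, Multiset.countP_map] using h2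
    · simpa [cnt, Multiset.countP_map] using h2'

lemma numeric_small (x : ℝ) (hx : 0 ≤ x) (hx' : x ≤ 10) :
    2 * x ≤ 7 * Real.sqrt (x * Real.log (1 + x)) := by
  have h1 : 2 * x / 7 ≤ Real.sqrt (x * Real.log (1 + x)) := by
    apply Real.le_sqrt_of_sq_le
    have h2 := Real.one_sub_inv_le_log_of_pos (by linarith : 0 < 1 + x)
    have h3 : x / 11 ≤ 1 - (1 + x)⁻¹ := by
      have : 1 - (1 + x)⁻¹ = x / (1 + x) := by field_simp; ring
      rw [this]
      gcongr
      linarith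
    have h4 : x / 11 ≤ Real.log (1 + x) := h3.trans h2
    nlinarith
  linarith

lemma numeric_large (x : ℝ) (hx : 10 ≤ x) :
    8 * Real.sqrt x + 4 ≤ 7 * Real.sqrt (x * Real.log (1 + x)) := by
  have h0 : (2 : ℝ) ≤ Real.log (1 + x) := by
    rw [Real.le_log_iff_exp_le (by linarith)]
    have : Real.exp 2 = Real.exp 1 * Real.exp 1 := by rw [← Real.exp_add]; norm_num
    have h3 := Real.exp_one_lt_d9
    have h4 := Real.exp_pos 1
    rw [this]; nlinarith
  have h1 : (3 : ℝ) ≤ Real.sqrt x := Real.le_sqrt_of_sq_le (by linarith)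
  have h2 : 1.4 * Real.sqrt x ≤ Real.sqrt (x * Real.log (1 + x)) := by
    apply Real.le_sqrt_of_sq_le
    rw [mul_pow, Real.sq_sqrt (by linarith)]
    nlinarith
  linarith

lemma Good.final {α : Type} [Fintype α] {c : α → Bool} {κ : ℝ} {Γ : Multiset (Sym2 α) → ℝ}
    (hG : Good c κ Γ) (hκ : 0 ≤ κ) {P P' : Multiset (Sym2 α)} {U U' : Multiset α}
    (h : Mt P U) (h' : Mt P' U') (hU : U.card ≤ 1)
    (m' : mixed c P' = 0) (v1 : cnt c true U' ≤ 1) (v2 : cnt c false U' ≤ 1) :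
    Γ P' ≤ Γ P + 7 * κ * Real.sqrt (((Fintype.card α : ℝ) / 2) *
      Real.log (1 + (Fintype.card α : ℝ) / 2)) := by
  have hm := mixed_le (c := c) h
  have h1 := hG.crude hκ h h' hU m' v1 v2
  have h2 := hG.main hκ h h' hU m' v1 v2
  set x : ℝ := (Fintype.card α : ℝ) / 2 with hxd
  have hx0 : 0 ≤ x := by positivity
  by_cases hx : x ≤ 10
  · have := numeric_small x hx0 hx
    nlinarith
  · push Not at hx
    have hn := numeric_large x hx.le
    have hs : 0 < Real.sqrt x := Real.sqrt_pos.2 (by linarith)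
    have hc := Nat.le_ceil (Real.sqrt x)
    have hc' := (Nat.ceil_lt_add_one hs.le).le
    have h3 := h2 ⌈Real.sqrt x⌉₊ (Nat.one_le_ceil_iff.2 hs)
    have h4 : 4 * x / (⌈Real.sqrt x⌉₊ : ℝ) ≤ 4 * Real.sqrt x := by
      rw [div_le_iff₀ (by linarith)]
      nlinarith [Real.mul_self_sqrt hx0]
    nlinarith

theorem statement3 (f : Multigraph → ℝ) (κ : ℝ)
    (hinv : GraphParam.Invariant f) (hadd : GraphParam.Additive f)
    (hlip : GraphParam.Lipschitz f κ) (hconc : GraphParam.Concave f)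
    (V : Type) [Fintype V] [DecidableEq V] (A B : Finset V)
    (hAB : Disjoint A B) (hUnion : A ∪ B = Finset.univ) (d : V → ℕ) :
    configExpect ↥A (fun i => d i.1) f + configExpect ↥B (fun i => d i.1) f ≤
      configExpect V d f +
        7 * κ * Real.sqrt (((∑ i : V, (d i : ℝ)) / 2) *
          Real.log (1 + (∑ i : V, (d i : ℝ)) / 2)) := by

  have hκ : 0 ≤ κ := (abs_nonneg _).trans (hlip ⟨Unit, 0⟩ () ())
  have hmemAB : ∀ i : V, i ∈ A ∨ i ∈ B := fun i =>
    Finset.mem_union.1 (hUnion ▸ Finset.mem_univ i)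
  have hdis : ∀ i, i ∈ A → i ∈ B → False := fun i h1 h2 => Finset.disjoint_left.1 hAB h1 h2
  set X := HalfEdge ↥A (fun i => d i.1) with hX
  set Y := HalfEdge ↥B (fun i => d i.1) with hY
  let φ : ↥A ⊕ ↥B → V := Sum.elim Subtype.val Subtype.val
  have hφ : Function.Bijective φ := by
    constructor
    · rintro (⟨a, ha⟩ | ⟨a, ha⟩) (⟨b, hb⟩ | ⟨b, hb⟩) h
      · simp only [φ, Sum.elim_inl] at h; subst h; rfl
      · simp only [φ, Sum.elim_inl, Sum.elim_inr] at h; subst h; exact (hdis _ ha hb).elim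
      · simp only [φ, Sum.elim_inl, Sum.elim_inr] at h; subst h; exact (hdis _ hb ha).elim
      · simp only [φ, Sum.elim_inr] at h; subst h; rfl
    · intro i
      rcases hmemAB i with h | h
      · exact ⟨Sum.inl ⟨i, h⟩, rfl⟩
      · exact ⟨Sum.inr ⟨i, h⟩, rfl⟩
  let ψ : X ⊕ Y → HalfEdge V d :=
    Sum.elim (fun h => ⟨h.1.1, h.2⟩) (fun h => ⟨h.1.1, h.2⟩)
  have hψ : Function.Bijective ψ := by
    constructor
    · rintro (⟨⟨a, ha⟩, s⟩ | ⟨⟨a, ha⟩, s⟩) (⟨⟨b, hb⟩, t⟩ | ⟨⟨b, hb⟩, t⟩) h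
      · simp only [ψ, Sum.elim_inl, Sigma.mk.injEq] at h
        obtain ⟨rfl, h⟩ := h
        obtain rfl := eq_of_heq h
        rfl
      · simp only [ψ, Sum.elim_inl, Sum.elim_inr, Sigma.mk.injEq] at h
        obtain ⟨rfl, h⟩ := h
        exact (hdis _ ha hb).elim
      · simp only [ψ, Sum.elim_inl, Sum.elim_inr, Sigma.mk.injEq] at h
        obtain ⟨rfl, h⟩ := h
        exact (hdis _ hb ha).elim
      · simp only [ψ, Sum.elim_inr, Sigma.mk.injEq] at h
        obtain ⟨rfl, h⟩ := h
        obtain rfl := eq_of_heq h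
        rfl
    · rintro ⟨i, s⟩
      rcases hmemAB i with h | h
      · exact ⟨Sum.inl ⟨⟨i, h⟩, s⟩, rfl⟩
      · exact ⟨Sum.inr ⟨⟨i, h⟩, s⟩, rfl⟩
  let e : X ⊕ Y ≃ HalfEdge V d := Equiv.ofBijective ψ hψ
  let v : X ⊕ Y → V := fun h => (ψ h).1
  let F : Multiset (Sym2 V) → ℝ := fun E => f ⟨V, E⟩
  have hG : Good (α := X ⊕ Y) Sum.isLeft κ (Gam v F) := good_Gam f κ hlip hconc v
  have hcard : (∑ i : V, (d i : ℝ)) = (Fintype.card (X ⊕ Y) : ℝ) := by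
    rw [Fintype.card_congr e]
    simp
  rw [hcard]
  -- the right-hand side
  have hR : configExpect V d f =
      (∑ m ∈ maxSet (X ⊕ Y), Gam v F m.val) / ((maxSet (X ⊕ Y)).card : ℝ) := by
    rw [sum_Gam, ← card_maxSet e]
    have h1 : maximalMatchings V d = maxSet (HalfEdge V d) := by
      ext m; simp [maximalMatchings, maxSet]
    unfold configExpect
    rw [h1]
    congr 1
    have := sum_maxSet e (fun P => F (P.map (Sym2.map Sigma.fst)))
    refine this.trans ?_
    apply Finset.sum_congr rfl
    intro m _
    congr 1
    rw [Multiset.map_map]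
    apply Multiset.map_congr rfl
    intro p _
    rw [Function.comp_apply, Sym2.map_map]
    rfl
  -- the left-hand side
  obtain ⟨m₁, hm₁⟩ := maxSet_nonempty X
  obtain ⟨m₂, hm₂⟩ := maxSet_nonempty Y
  have pX : (0 : ℝ) < (maxSet X).card := by exact_mod_cast Finset.card_pos.2 ⟨m₁, hm₁⟩
  have pY : (0 : ℝ) < (maxSet Y).card := by exact_mod_cast Finset.card_pos.2 ⟨m₂, hm₂⟩
  have pXY : (0 : ℝ) < (maxSet (X ⊕ Y)).card := by
    exact_mod_cast Finset.card_pos.2 (maxSet_nonempty _)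
  obtain ⟨x1, U', x2, x3, x4⟩ := pairU_spec m₁ m₂ ((mem_maxSet _).1 hm₁) ((mem_maxSet _).1 hm₂)
  have hL : configExpect ↥A (fun i => d i.1) f + configExpect ↥B (fun i => d i.1) f =
      Gam v F (pairU m₁.val m₂.val) := by
    have h1 : maximalMatchings ↥A (fun i => d i.1) = maxSet X := by
      ext m; simp [maximalMatchings, maxSet, hX]
    have h2 : maximalMatchings ↥B (fun i => d i.1) = maxSet Y := by
      ext m; simp [maximalMatchings, maxSet, hY]
    have hsum : ∀ (m : Finset (Sym2 X)) (m' : Finset (Sym2 Y)),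
        f (matchingGraph ↥A (fun i => d i.1) m) + f (matchingGraph ↥B (fun i => d i.1) m') =
        F ((pairU m.val m'.val).map (Sym2.map v)) := by
      intro m m'
      rw [← hadd]
      refine hinv _ _ (Equiv.ofBijective φ hφ) ?_
      change (pairU m.val m'.val).map (Sym2.map v) = Multiset.map (Sym2.map φ)
        ((m.val.map (Sym2.map (Sigma.fst : X → ↥A))).map (Sym2.map (Sum.inl : ↥A → ↥A ⊕ ↥B)) +
          (m'.val.map (Sym2.map (Sigma.fst : Y → ↥B))).map (Sym2.map (Sum.inr : ↥B → ↥A ⊕ ↥B)))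
      simp only [pairU, Multiset.map_add, Multiset.map_map, Function.comp_def, Sym2.map_map]
      rfl
    have hs := sum_Gam_pair v F
    simp only [← hsum] at hs
    have hconst : ∀ m ∈ maxSet X, ∀ m' ∈ maxSet Y,
        Gam v F (pairU m.val m'.val) = Gam v F (pairU m₁.val m₂.val) := by
      intro m hm m' hm'
      obtain ⟨y1, U, y2, y3, y4⟩ := pairU_spec m m' ((mem_maxSet _).1 hm) ((mem_maxSet _).1 hm')
      exact hG.pure_eq y2 x2 y1 x1 y3 y4 x3 x4
    rw [Finset.sum_congr rfl (fun m hm => Finset.sum_congr rfl (hconst m hm))] at hs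
    simp only [Finset.sum_add_distrib, Finset.sum_const, nsmul_eq_mul, ← Finset.mul_sum] at hs
    unfold configExpect
    rw [h1, h2]
    field_simp
    linarith
  rw [hL, hR]
  set R := 7 * κ * Real.sqrt (((Fintype.card (X ⊕ Y) : ℝ) / 2) *
      Real.log (1 + (Fintype.card (X ⊕ Y) : ℝ) / 2)) with hRdef
  rw [← sub_le_iff_le_add, le_div_iff₀ pXY]
  calc (Gam v F (pairU m₁.val m₂.val) - R) * ((maxSet (X ⊕ Y)).card : ℝ)
      = ∑ m ∈ maxSet (X ⊕ Y), (Gam v F (pairU m₁.val m₂.val) - R) := by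
        rw [Finset.sum_const, nsmul_eq_mul, mul_comm]
    _ ≤ _ := by
        apply Finset.sum_le_sum
        intro m hm
        obtain ⟨U, hU, hU1⟩ := exists_free m ((mem_maxSet _).1 hm)
        have := hG.final hκ hU x2 hU1 x1 x3 x4
        linarith
end
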